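/- arXiv:math/0502458 — 2 statements merged into one kernel-verified Lean document; each statement's English description precedes it below -/
import Mathlib

section
/- Let (X,T,m,α) be a probability preserving Gibbs-Markov map with expansion constant λ>1, with values in a locally compact abelian group G with invariant metric. If f:X→G satisfies Σ_{a∈α} m(a)·Df(a) < ∞ (where Df(a) is the essential Lipschitz constant of f on a) and u:X→G is measurable with f = u - u∘T almost everywhere, then sup_{a*∈α*} Du(a*) < ∞, where α* is the partition generated by the images of elements of α; moreover u is essentially bounded. -/
open MeasureTheory Filter ENNReal

variable {X G ι : Type*}

/-- The essential Lipschitz constant of `f` on the set `Z`: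
the infimum of constants `C` such that `edist (f x) (f y) ≤ C * edist x y`
for `x, y` in a full-measure subset of `Z`. -/
noncomputable def essLip [PseudoEMetricSpace X] [PseudoEMetricSpace G] [MeasurableSpace X]
    (m : Measure X) (f : X → G) (Z : Set X) : ℝ≥0∞ :=
  sInf {C : ℝ≥0∞ | ∃ Ω : Set X, Ω ⊆ Z ∧ m (Z \ Ω) = 0 ∧
    ∀ x ∈ Ω, ∀ y ∈ Ω, edist (f x) (f y) ≤ C * edist x y}

/-- A Gibbs-Markov map: a nonsingular map `T` on a bounded metric probability space
with a countable Markov partition `α` of positive-measure sets, with big images and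
preimages, expansion by a factor `lam > 1`, and bounded distortion of the inverse
Jacobian `g`. -/
structure GibbsMarkov [MetricSpace X] [MeasurableSpace X]
    (m : Measure X) (T : X → X) (α : ι → Set X) (lam : ℝ) : Prop where
  countable : Countable ι
  bounded : Bornology.IsBounded (Set.univ : Set X)
  measT : Measurable T
  meas : ∀ i, MeasurableSet (α i)
  pos : ∀ i, 0 < m (α i)
  disj : Pairwise (Function.onFun Disjoint α)
  cover : m (⋃ i, α i)ᶜ = 0
  inj : ∀ i, Set.InjOn T (α i)
  markov : ∀ i, ∃ s : Set ι, m (symmDiff (T '' α i) (⋃ j ∈ s, α j)) = 0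
  bip : ∃ F : Finset ι, ∀ i : ι, (∃ i' ∈ F, m (α i \ T '' α i') = 0) ∧
        (∃ j' ∈ F, m (α j' \ T '' α i) = 0)
  one_lt_lam : 1 < lam
  expand : ∀ i, ∃ Ω : Set X, Ω ⊆ α i ∧ m (α i \ Ω) = 0 ∧
      ∀ x ∈ Ω, ∀ y ∈ Ω, lam * dist x y ≤ dist (T x) (T y)
  distortion : ∃ g : X → ℝ, (∀ x, 0 < g x) ∧
      (∀ i, ∀ s : Set X, s ⊆ α i → MeasurableSet s →
        m (T '' s) = ∫⁻ x in s, ENNReal.ofReal (g x)⁻¹ ∂m) ∧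
      ∃ C : ℝ, 0 < C ∧ ∀ i, ∃ Ω : Set X, Ω ⊆ α i ∧ m (α i \ Ω) = 0 ∧
        ∀ x ∈ Ω, ∀ y ∈ Ω, |1 - g x / g y| ≤ C * dist (T x) (T y)

/-- `A` is an atom of the partition `α*` generated by the images of the elements
of the partition `α` under `T`. -/
def isImageAtom (T : X → X) (α : ι → Set X) (A : Set X) : Prop :=
  A.Nonempty ∧ ∃ S : Set ι,
    A = (⋂ i ∈ S, T '' α i) ∩ (⋂ i ∈ Sᶜ, (T '' α i)ᶜ)

/-- Points whose itinerary follows `w` for the first `n` steps. -/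
def cyl (T : X → X) (α : ι → Set X) (n : ℕ) (w : ℕ → ι) : Set X :=
  {x | ∀ k < n, T^[k] x ∈ α (w k)}

/-- A forward invariant full measure set on which all a.e. properties hold everywhere. -/
structure GoodSet [MetricSpace X] [MeasurableSpace X] [MetricSpace G] [AddCommGroup G]
    (m : Measure X) (T : X → X) (α : ι → Set X) (lam D C : ℝ) (g : X → ℝ) (l : ι → ℝ≥0∞)
    (f u : X → G) (Y : Set X) : Prop where
  conull : m Yᶜ = 0
  maps : ∀ x ∈ Y, T x ∈ Y
  cov : ∀ x ∈ Y, ∃ i, x ∈ α i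
  expand : ∀ i, ∀ x ∈ Y, x ∈ α i → ∀ y ∈ Y, y ∈ α i → lam * dist x y ≤ dist (T x) (T y)
  distn : ∀ i, ∀ x ∈ Y, x ∈ α i → ∀ y ∈ Y, y ∈ α i → |1 - g x / g y| ≤ C * dist (T x) (T y)
  lip : ∀ i, ∀ x ∈ Y, x ∈ α i → ∀ y ∈ Y, y ∈ α i → edist (f x) (f y) ≤ l i * edist x y
  cob : ∀ x ∈ Y, u (T x) = u x - f x
  mark : ∀ i j, ∀ x ∈ Y, x ∈ α i → T x ∈ α j → m (α j \ T '' α i) = 0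
  hlam : 1 < lam
  hC : 0 < C
  hD : 0 < D
  diam : ∀ x y : X, dist x y ≤ D
  gpos : ∀ x, 0 < g x
  jac : ∀ i, ∀ s : Set X, s ⊆ α i → MeasurableSet s →
        m (T '' s) = ∫⁻ x in s, ENNReal.ofReal (g x)⁻¹ ∂m
  pos : ∀ i, 0 < m (α i)
  meas : ∀ i, MeasurableSet (α i)
  disj : Pairwise (Function.onFun Disjoint α)
  ctb : Countable ι
  mpT : MeasurePreserving T m m

theorem exists_forward_invariant [MeasurableSpace X] (m : Measure X) (T : X → X)
    (hT : MeasurePreserving T m m) (p : X → Prop) (hp : ∀ᵐ x ∂m, p x) :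
    ∃ Y : Set X, m Yᶜ = 0 ∧ (∀ x ∈ Y, T x ∈ Y) ∧ ∀ x ∈ Y, p x := by
  refine ⟨{x | ∀ n, p (T^[n] x)}, ?_, ?_, ?_⟩
  · change ∀ᵐ x ∂m, ∀ n, p (T^[n] x)
    rw [ae_all_iff]
    intro n
    exact (hT.iterate n).quasiMeasurePreserving.ae hp
  · intro x hx n
    exact hx (n + 1)
  · intro x hx
    exact hx 0

theorem image_null [MetricSpace X] [MeasurableSpace X] (m : Measure X) (T : X → X)
    (a : Set X) (ha : MeasurableSet a) (g : X → ℝ)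
    (hj : ∀ s : Set X, s ⊆ a → MeasurableSet s →
        m (T '' s) = ∫⁻ x in s, ENNReal.ofReal (g x)⁻¹ ∂m)
    (s : Set X) (hs : s ⊆ a) (h0 : m s = 0) : m (T '' s) = 0 := by
  have h1 : m (T '' (toMeasurable m s ∩ a)) = 0 := by
    rw [hj _ Set.inter_subset_right ((measurableSet_toMeasurable m s).inter ha)]
    apply setLIntegral_measure_zero
    exact measure_mono_null Set.inter_subset_left (by rw [measure_toMeasurable, h0])
  exact measure_mono_null (Set.image_mono (Set.subset_inter (subset_toMeasurable m s) hs)) h1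

theorem exists_goodSet [MetricSpace X] [MeasurableSpace X] [BorelSpace X]
    [MetricSpace G] [AddCommGroup G]
    (m : Measure X) [IsProbabilityMeasure m]
    (T : X → X) (hpres : MeasurePreserving T m m)
    (α : ι → Set X) (lam : ℝ) (hGM : GibbsMarkov m T α lam)
    (f u : X → G)
    (hf : ∑' i, m (α i) * essLip m f (α i) ≠ ⊤)
    (hcob : ∀ᵐ x ∂m, f x = u x - u (T x)) :
    ∃ D C g l Y, GoodSet m T α lam D C g l f u Y ∧ ∑' i, m (α i) * l i ≠ ⊤ := by
  obtain ⟨g, gpos, jac, C, hC, hdis⟩ := hGM.distortion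
  have hc := hGM.countable
  obtain ⟨D, hD⟩ := Metric.isBounded_iff.1 hGM.bounded
  have hfin : ∀ i, essLip m f (α i) ≠ ⊤ := by
    intro i hi
    have := ENNReal.ne_top_of_tsum_ne_top hf i
    rw [hi, ENNReal.mul_top (hGM.pos i).ne'] at this
    exact this rfl
  have hLip : ∀ i, ∃ Ω : Set X, Ω ⊆ α i ∧ m (α i \ Ω) = 0 ∧
      ∀ x ∈ Ω, ∀ y ∈ Ω, edist (f x) (f y) ≤ (essLip m f (α i) + 1) * edist x y := by
    intro i
    have h1 : essLip m f (α i) < essLip m f (α i) + 1 :=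
      ENNReal.lt_add_right (hfin i) one_ne_zero
    obtain ⟨c, ⟨Ω, h2, h3, h4⟩, hc⟩ := sInf_lt_iff.1 h1
    exact ⟨Ω, h2, h3, fun x hx y hy => (h4 x hx y hy).trans (by gcongr)⟩
  choose Ω1 _ hΩ1n hΩ1 using hLip
  choose Ω2 _ hΩ2n hΩ2 using hGM.expand
  choose Ω3 _ hΩ3n hΩ3 using hdis
  have key : ∀ (Ω : ι → Set X), (∀ i, m (α i \ Ω i) = 0) → ∀ᵐ x ∂m, ∀ i, x ∈ α i → x ∈ Ω i := by
    intro Ω h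
    rw [ae_all_iff]
    intro i
    have := measure_eq_zero_iff_ae_notMem.1 (h i)
    filter_upwards [this] with x hx hxi
    by_contra hh
    exact hx ⟨hxi, hh⟩
  have hcov : ∀ᵐ x ∂m, ∃ i, x ∈ α i := by
    have := measure_eq_zero_iff_ae_notMem.1 hGM.cover
    filter_upwards [this] with x hx
    simpa using hx
  have hmark : ∀ᵐ x ∂m, ∀ i j, x ∈ α i → T x ∈ α j → m (α j \ T '' α i) = 0 := by
    rw [ae_all_iff]; intro i
    rw [ae_all_iff]; intro j
    by_cases h0 : m (T '' α i ∩ α j) = 0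
    · have h1 : ∀ᵐ x ∂m, T x ∉ T '' α i ∩ α j :=
        hpres.quasiMeasurePreserving.ae (measure_eq_zero_iff_ae_notMem.1 h0)
      filter_upwards [h1] with x hx hxi hxj
      exact absurd ⟨Set.mem_image_of_mem T hxi, hxj⟩ hx
    · refine Eventually.of_forall fun x _ _ => ?_
      obtain ⟨s, hs⟩ := hGM.markov i
      by_cases hj : j ∈ s
      · refine measure_mono_null ?_ hs
        intro y hy
        exact Or.inr ⟨Set.mem_biUnion hj hy.1, hy.2⟩
      · exfalso
        apply h0
        refine measure_mono_null ?_ hs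
        intro y hy
        refine Or.inl ⟨hy.1, ?_⟩
        intro hy2
        obtain ⟨k, hk, hyk⟩ := Set.mem_iUnion₂.1 hy2
        have : k ≠ j := fun h => hj (h ▸ hk)
        exact Set.disjoint_left.1 (hGM.disj this) hyk hy.2
  obtain ⟨Y, hY0, hYT, hY⟩ := exists_forward_invariant m T hpres
    (fun x => (∀ i, x ∈ α i → x ∈ Ω1 i) ∧ (∀ i, x ∈ α i → x ∈ Ω2 i) ∧
      (∀ i, x ∈ α i → x ∈ Ω3 i) ∧ (∃ i, x ∈ α i) ∧
      (∀ i j, x ∈ α i → T x ∈ α j → m (α j \ T '' α i) = 0) ∧ f x = u x - u (T x))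
    (by filter_upwards [key Ω1 hΩ1n, key Ω2 hΩ2n, key Ω3 hΩ3n, hcov, hmark, hcob] with
          x h1 h2 h3 h4 h5 h6 using ⟨h1, h2, h3, h4, h5, h6⟩)
  refine ⟨max D 1, C, g, fun i => essLip m f (α i) + 1, Y, ?_, ?_⟩
  · exact
    { conull := hY0
      maps := hYT
      cov := fun x hx => (hY x hx).2.2.2.1
      expand := fun i x hx hxi y hy hyi =>
        hΩ2 i x ((hY x hx).2.1 i hxi) y ((hY y hy).2.1 i hyi)
      distn := fun i x hx hxi y hy hyi =>
        hΩ3 i x ((hY x hx).2.2.1 i hxi) y ((hY y hy).2.2.1 i hyi)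
      lip := fun i x hx hxi y hy hyi =>
        hΩ1 i x ((hY x hx).1 i hxi) y ((hY y hy).1 i hyi)
      cob := fun x hx => by rw [(hY x hx).2.2.2.2.2]; abel
      mark := fun i j x hx => (hY x hx).2.2.2.2.1 i j
      hlam := hGM.one_lt_lam
      hC := hC
      hD := by positivity
      diam := fun x y => (hD (Set.mem_univ x) (Set.mem_univ y)).trans (le_max_left _ _)
      gpos := gpos
      jac := jac
      pos := hGM.pos
      meas := hGM.meas
      disj := hGM.disj
      ctb := hc
      mpT := hpres }
  · simp only [mul_add, mul_one]
    rw [ENNReal.tsum_add]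
    refine ENNReal.add_ne_top.2 ⟨hf, ?_⟩
    rw [← measure_iUnion hGM.disj hGM.meas]
    exact measure_ne_top _ _

set_option linter.unusedSectionVars false

section dyn

variable [MetricSpace X] [MeasurableSpace X] [BorelSpace X] [MetricSpace G] [AddCommGroup G]
    {m : Measure X} [IsProbabilityMeasure m] {T : X → X} {α : ι → Set X} {lam D C : ℝ}
    {g : X → ℝ} {l : ι → ℝ≥0∞} {f u : X → G} {Y : Set X}

theorem GoodSet.iter_mem (h : GoodSet m T α lam D C g l f u Y) (n : ℕ) :
    ∀ x ∈ Y, T^[n] x ∈ Y := by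
  induction n with
  | zero => intro x hx; exact hx
  | succ n ih => intro x hx; exact ih _ (h.maps x hx)

theorem GoodSet.meas_cyl (h : GoodSet m T α lam D C g l f u Y) (n : ℕ) (w : ℕ → ι) :
    MeasurableSet (cyl T α n w) := by
  have : cyl T α n w = ⋂ k ∈ Finset.range n, T^[k] ⁻¹' α (w k) := by
    ext x; simp [cyl]
  rw [this]
  exact Finset.measurableSet_biInter _ fun k _ => (h.mpT.measurable.iterate k) (h.meas _)

theorem cyl_succ_iff {n : ℕ} {w : ℕ → ι} {x : X} :
    x ∈ cyl T α (n + 1) w ↔ x ∈ α (w 0) ∧ T x ∈ cyl T α n (fun k => w (k + 1)) := by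
  constructor
  · intro hx
    exact ⟨hx 0 (Nat.succ_pos _), fun k hk => hx (k + 1) (by omega)⟩
  · rintro ⟨h0, h1⟩ k hk
    cases k with
    | zero => exact h0
    | succ k => exact h1 k (by omega)

theorem cyl_succ_iff' {n : ℕ} {w : ℕ → ι} {x : X} :
    x ∈ cyl T α (n + 1) w ↔ x ∈ cyl T α n w ∧ T^[n] x ∈ α (w n) := by
  constructor
  · intro hx
    exact ⟨fun k hk => hx k (by omega), hx n (by omega)⟩
  · rintro ⟨h0, h1⟩ k hk
    rcases Nat.lt_succ_iff_lt_or_eq.1 hk with h | rfl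
    · exact h0 k h
    · exact h1

theorem GoodSet.dist_cyl (h : GoodSet m T α lam D C g l f u Y) (n : ℕ) :
    ∀ (w : ℕ → ι) (x y : X), x ∈ Y → y ∈ Y → x ∈ cyl T α n w → y ∈ cyl T α n w →
      dist x y ≤ (lam⁻¹) ^ n * D := by
  have hl : 0 < lam := one_pos.trans h.hlam
  induction n with
  | zero => intro w x y _ _ _ _; simpa using h.diam x y
  | succ n ih =>
    intro w x y hx hy hxc hyc
    rw [cyl_succ_iff] at hxc hyc
    have h1 := ih _ _ _ (h.maps x hx) (h.maps y hy) hxc.2 hyc.2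
    have h2 := h.expand _ x hx hxc.1 y hy hyc.1
    rw [pow_succ]
    calc dist x y = lam⁻¹ * (lam * dist x y) := by field_simp
      _ ≤ lam⁻¹ * ((lam⁻¹) ^ n * D) := by exact mul_le_mul_of_nonneg_left (h2.trans h1) (inv_nonneg.2 hl.le)
      _ = _ := by ring

theorem GoodSet.g_ratio (h : GoodSet m T α lam D C g l f u Y) {i : ι} {x y : X}
    (hx : x ∈ Y) (hxi : x ∈ α i) (hy : y ∈ Y) (hyi : y ∈ α i) {t : ℝ} (ht : dist (T x) (T y) ≤ t) :
    g x ≤ Real.exp (C * t) * g y := by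
  have h1 := h.distn i x hx hxi y hy hyi
  have h2 : g x / g y ≤ 1 + C * t := by
    have := (abs_le.1 h1).1
    have h3 : C * dist (T x) (T y) ≤ C * t := by gcongr; exact h.hC.le
    linarith
  have h4 : g x / g y ≤ Real.exp (C * t) := by
    have := Real.add_one_le_exp (C * t); linarith
  rwa [div_le_iff₀ (h.gpos y)] at h4

/-- The distortion constants. -/
noncomputable def Kd (lam D C : ℝ) : ℕ → ℝ
  | 0 => 0
  | n + 1 => Kd lam D C n + 2 * (C * ((lam⁻¹) ^ n * D))

theorem GoodSet.Kd_le (h : GoodSet m T α lam D C g l f u Y) (n : ℕ) :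
    Kd lam D C n ≤ 2 * C * D * (1 - lam⁻¹)⁻¹ := by
  have hl : lam⁻¹ < 1 := inv_lt_one_of_one_lt₀ h.hlam
  have hl0 : 0 < lam⁻¹ := inv_pos.2 (one_pos.trans h.hlam)
  have h1 : Kd lam D C n = 2 * C * D * (1 - lam⁻¹)⁻¹ * (1 - (lam⁻¹) ^ n) := by
    induction n with
    | zero => simp [Kd]
    | succ n ih =>
      rw [Kd, ih]
      have : 1 - lam⁻¹ ≠ 0 := by linarith
      generalize lam⁻¹ = r at *
      field_simp
      ring
  rw [h1]
  have h2 : 0 ≤ 2 * C * D * (1 - lam⁻¹)⁻¹ := by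
    have := h.hC; have := h.hD
    have : 0 < 1 - lam⁻¹ := by linarith
    positivity
  have h3 : 0 ≤ (lam⁻¹) ^ n := by positivity
  nlinarith

theorem GoodSet.distortion (h : GoodSet m T α lam D C g l f u Y) (n : ℕ) :
    ∀ (w : ℕ → ι) (z : X) (s : Set X), z ∈ Y → z ∈ cyl T α n w → s ⊆ Y → s ⊆ cyl T α n w →
      m (T^[n] '' s) * m (cyl T α n w) ≤ ENNReal.ofReal (Real.exp (Kd lam D C n)) * m s := by
  induction n with
  | zero =>
    intro w z s hz hzc hs hsc
    have : cyl T α 0 w = Set.univ := by ext; simp [cyl]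
    simp [this, Kd]
  | succ n ih =>
    intro w z s hz hzc hs hsc
    have hzc' := cyl_succ_iff.1 hzc
    set w' : ℕ → ι := fun k => w (k + 1) with hw'
    set t : ℝ := (lam⁻¹) ^ n * D with ht
    have hr : ∀ x ∈ Y, x ∈ cyl T α (n + 1) w → dist (T x) (T z) ≤ t := by
      intro x hx hxc
      exact h.dist_cyl n w' _ _ (h.maps x hx) (h.maps z hz) (cyl_succ_iff.1 hxc).2 hzc'.2
    have hIH := ih w' (T z) (T '' s) (h.maps z hz) hzc'.2
      (by rintro _ ⟨x, hx, rfl⟩; exact h.maps x (hs hx))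
      (by rintro _ ⟨x, hx, rfl⟩; exact (cyl_succ_iff.1 (hsc hx)).2)
    rw [← Set.image_comp, ← Function.iterate_succ] at hIH
    have hgz := h.gpos z
    -- upper bound
    have hup : m (T '' s) ≤ ENNReal.ofReal (Real.exp (C * t) * (g z)⁻¹) * m s := by
      set S := toMeasurable m s ∩ cyl T α (n + 1) w with hS
      have hSm : MeasurableSet S := (measurableSet_toMeasurable m s).inter (h.meas_cyl _ _)
      have h1 : m (T '' s) ≤ m (T '' S) :=
        measure_mono (Set.image_mono (Set.subset_inter (subset_toMeasurable m s) hsc))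
      have hSa : S ⊆ α (w 0) := fun x hx => (cyl_succ_iff.1 hx.2).1
      rw [h.jac (w 0) S hSa hSm] at h1
      refine h1.trans ?_
      have h2 : ∫⁻ x in S, ENNReal.ofReal (g x)⁻¹ ∂m ≤
          ∫⁻ x in S, ENNReal.ofReal (Real.exp (C * t) * (g z)⁻¹) ∂m := by
        apply lintegral_mono_ae
        rw [ae_restrict_iff' hSm]
        filter_upwards [measure_eq_zero_iff_ae_notMem.1 h.conull] with x hx hxS
        have hxY : x ∈ Y := by simpa using hx
        apply ENNReal.ofReal_le_ofReal
        have h3 := h.g_ratio hz hzc'.1 hxY (hSa hxS) (t := t)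
          (by rw [dist_comm]; exact hr x hxY hxS.2)
        have := h.gpos x
        rw [← div_eq_mul_inv, le_div_iff₀ hgz, inv_mul_le_iff₀ this, mul_comm (g x)]
        exact h3
      refine h2.trans ?_
      rw [setLIntegral_const]
      refine mul_le_mul_right ?_ _
      calc m S ≤ m (toMeasurable m s) := measure_mono Set.inter_subset_left
        _ = m s := measure_toMeasurable s
    have hlow : ENNReal.ofReal (Real.exp (-(C * t)) * (g z)⁻¹) * m (cyl T α (n + 1) w) ≤
        m (cyl T α n w') := by
      set S := cyl T α (n + 1) w with hS
      have hSm : MeasurableSet S := h.meas_cyl _ _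
      have hSa : S ⊆ α (w 0) := fun x hx => (cyl_succ_iff.1 hx).1
      have h1 : m (T '' S) ≤ m (cyl T α n w') := by
        apply measure_mono
        rintro _ ⟨x, hx, rfl⟩
        exact (cyl_succ_iff.1 hx).2
      rw [h.jac (w 0) S hSa hSm] at h1
      refine le_trans ?_ h1
      rw [← setLIntegral_const]
      apply lintegral_mono_ae
      rw [ae_restrict_iff' hSm]
      filter_upwards [measure_eq_zero_iff_ae_notMem.1 h.conull] with x hx hxS
      have hxY : x ∈ Y := by simpa using hx
      apply ENNReal.ofReal_le_ofReal
      have h3 := h.g_ratio hxY (hSa hxS) hz hzc'.1 (t := t) (hr x hxY hxS)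
      have := h.gpos x
      rw [Real.exp_neg, ← mul_inv]
      exact inv_anti₀ this h3
    set a : ℝ := Real.exp (-(C * t)) * (g z)⁻¹ with ha
    have hapos : 0 < a := by positivity
    have hb : Real.exp (C * t) * (g z)⁻¹ = a * Real.exp (2 * (C * t)) := by
      rw [ha, two_mul, Real.exp_add, Real.exp_neg]
      have := Real.exp_pos (C * t)
      field_simp
    rw [hb, ENNReal.ofReal_mul hapos.le] at hup
    have ha0 : ENNReal.ofReal a ≠ 0 := by simpa using hapos
    refine (ENNReal.mul_le_mul_iff_right ha0 ENNReal.ofReal_ne_top).1 ?_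
    calc ENNReal.ofReal a * (m (T^[n + 1] '' s) * m (cyl T α (n + 1) w))
        = m (T^[n + 1] '' s) * (ENNReal.ofReal a * m (cyl T α (n + 1) w)) := by ring
      _ ≤ m (T^[n + 1] '' s) * m (cyl T α n w') := by gcongr
      _ ≤ _ := hIH
      _ ≤ ENNReal.ofReal (Real.exp (Kd lam D C n)) *
          (ENNReal.ofReal a * ENNReal.ofReal (Real.exp (2 * (C * t))) * m s) := by gcongr
      _ = _ := by
        have hK : ENNReal.ofReal (Real.exp (Kd lam D C (n + 1))) =
            ENNReal.ofReal (Real.exp (Kd lam D C n)) *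
              ENNReal.ofReal (Real.exp (2 * (C * t))) := by
          rw [Kd, Real.exp_add, ENNReal.ofReal_mul (Real.exp_pos _).le]
        rw [hK]
        ring

theorem GoodSet.image_null (h : GoodSet m T α lam D C g l f u Y) (s : Set X) (hs : s ⊆ Y)
    (h0 : m s = 0) : m (T '' s) = 0 := by
  have := h.ctb
  have h1 : T '' s ⊆ ⋃ i, T '' (s ∩ α i) := by
    rintro _ ⟨x, hx, rfl⟩
    obtain ⟨i, hi⟩ := h.cov x (hs hx)
    exact Set.mem_iUnion.2 ⟨i, x, ⟨hx, hi⟩, rfl⟩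
  refine measure_mono_null h1 (measure_iUnion_null fun i => ?_)
  exact _root_.image_null m T (α i) (h.meas i) g (h.jac i) _ Set.inter_subset_right
    (measure_mono_null Set.inter_subset_left h0)

theorem GoodSet.iter_image_null (h : GoodSet m T α lam D C g l f u Y) (n : ℕ) :
    ∀ (s : Set X), s ⊆ Y → m s = 0 → m (T^[n] '' s) = 0 := by
  induction n with
  | zero => intro s _ h0; simpa using h0
  | succ n ih =>
    intro s hs h0
    rw [Function.iterate_succ, Set.image_comp]
    exact ih _ (by rintro _ ⟨x, hx, rfl⟩; exact h.maps x (hs hx)) (h.image_null s hs h0)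

theorem GoodSet.surj (h : GoodSet m T α lam D C g l f u Y) (n : ℕ) :
    ∀ (w : ℕ → ι) (z : X) (i : ι), z ∈ Y → z ∈ cyl T α n w → T^[n] z ∈ α i →
      m (α i \ T^[n] '' (cyl T α n w ∩ Y)) = 0 := by
  induction n with
  | zero =>
    intro w z i _ _ _
    refine measure_mono_null ?_ h.conull
    rintro x ⟨_, hx⟩ hxY
    exact hx ⟨x, ⟨fun k hk => by omega, hxY⟩, rfl⟩
  | succ n ih =>
    intro w z i hz hzc hzi
    rw [cyl_succ_iff'] at hzc
    have h1 := ih w z (w n) hz hzc.1 hzc.2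
    rw [Function.iterate_succ_apply'] at hzi
    have h2 := h.mark (w n) i _ (h.iter_mem n z hz) hzc.2 hzi
    have h3 := _root_.image_null m T (α (w n)) (h.meas _) g (h.jac _) _ Set.sdiff_subset h1
    refine measure_mono_null ?_ (measure_union_null h2 h3)
    rintro p ⟨hpi, hp⟩
    by_cases hpT : p ∈ T '' α (w n)
    · right
      obtain ⟨q, hq, rfl⟩ := hpT
      refine ⟨q, ⟨hq, ?_⟩, rfl⟩
      rintro ⟨v, ⟨hvc, hvY⟩, rfl⟩
      apply hp
      refine ⟨v, ⟨cyl_succ_iff'.2 ⟨hvc, hq⟩, hvY⟩, ?_⟩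
      rw [Function.iterate_succ_apply']
    · exact Or.inl ⟨hpi, hpT⟩

theorem GoodSet.cyl_pos (h : GoodSet m T α lam D C g l f u Y) {n : ℕ}
    {w : ℕ → ι} {z : X} {i : ι} (hz : z ∈ Y) (hzc : z ∈ cyl T α n w) (hzi : T^[n] z ∈ α i) :
    m (cyl T α n w) ≠ 0 := by
  intro h0
  have h1 := h.surj n w z i hz hzc hzi
  have h2 := h.iter_image_null n (cyl T α n w ∩ Y) Set.inter_subset_right
    (measure_mono_null Set.inter_subset_left h0)
  refine (h.pos i).ne' (measure_mono_null ?_ (measure_union_null h1 h2))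
  intro x hx
  by_cases hxx : x ∈ T^[n] '' (cyl T α n w ∩ Y)
  · exact Or.inr hxx
  · exact Or.inl ⟨hx, hxx⟩

/-- `v` is almost everywhere covered by countably many measurable pieces of small oscillation. -/
def CovProp {E : Type*} [PseudoMetricSpace E] (m : Measure X) (v : X → E) : Prop :=
  ∀ ε : ℝ, 0 < ε → ∃ B : ℕ → Set X, (∀ k, MeasurableSet (B k)) ∧ m (⋃ k, B k)ᶜ = 0 ∧
    ∀ k, ∀ x ∈ B k, ∀ y ∈ B k, dist (v x) (v y) ≤ ε

theorem lusin_osc {E : Type*} [PseudoMetricSpace E] {v : X → E} (hv : CovProp m v)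
    {ε : ℝ} (hε : 0 < ε) {η : ℝ≥0∞} (hη : η ≠ 0) :
    ∃ δ : ℝ, 0 < δ ∧ ∃ P : Set X, m P ≤ η ∧ ∀ z ∉ P, ∀ w ∉ P, dist z w < δ →
      dist (v z) (v w) ≤ ε := by
  obtain ⟨B, hBm, hBc, hB⟩ := hv ε hε
  have hη2 : η / 2 ≠ 0 := by simpa using hη
  obtain ⟨e, he, hes⟩ := ENNReal.exists_pos_sum_of_countable' hη2 ℕ
  have hU : ∀ k, ∃ U, B k ⊆ U ∧ IsOpen U ∧ m (U \ B k) < e k := by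
    intro k
    obtain ⟨U, h1, h2, _, h3⟩ := (hBm k).exists_isOpen_sdiff_lt (measure_ne_top m _) (he k).ne'
    exact ⟨U, h1, h2, h3⟩
  choose U hBU hUo hUm using hU
  let V : ℕ → Set X := fun n => ⋃ k, B k ∩ {z | Metric.ball z (1 / ((n : ℝ) + 1)) ⊆ U k}
  have hVm : ∀ n, MeasurableSet (V n) := by
    intro n
    refine MeasurableSet.iUnion fun k => (hBm k).inter ?_
    have : {z | Metric.ball z (1 / ((n : ℝ) + 1)) ⊆ U k} =
        (⋃ y ∈ (U k)ᶜ, Metric.ball y (1 / ((n : ℝ) + 1)))ᶜ := by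
      ext z
      simp only [Set.mem_ofPred_eq, Set.mem_compl_iff, Set.mem_iUnion, not_exists]
      constructor
      · intro hz y hy hzy
        exact hy (hz (by rwa [Metric.mem_ball, dist_comm]))
      · intro hz y hy
        by_contra hyU
        exact hz y hyU (by rwa [Metric.mem_ball, dist_comm])
    rw [this]
    exact (isOpen_biUnion fun _ _ => Metric.isOpen_ball).measurableSet.compl
  have hVmono : Antitone fun n => (V n)ᶜ := by
    intro a b hab
    apply Set.compl_subset_compl.2
    refine Set.iUnion_mono fun k => ?_
    rintro z ⟨h1, h2⟩
    refine ⟨h1, (Metric.ball_subset_ball ?_).trans h2⟩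
    exact Nat.one_div_le_one_div hab
  have hVlim : Tendsto (fun n => m (V n)ᶜ) atTop (nhds (m (⋂ n, (V n)ᶜ))) :=
    tendsto_measure_iInter_atTop (fun n => (hVm n).compl.nullMeasurableSet) hVmono
      ⟨0, measure_ne_top _ _⟩
  have hV0 : m (⋂ n, (V n)ᶜ) = 0 := by
    refine measure_mono_null ?_ hBc
    intro z hz hzB
    obtain ⟨k, hk⟩ := Set.mem_iUnion.1 hzB
    obtain ⟨r, hr, hrU⟩ := Metric.isOpen_iff.1 (hUo k) z (hBU k hk)
    obtain ⟨n, hn⟩ := exists_nat_one_div_lt hr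
    exact Set.mem_iInter.1 hz n
      (Set.mem_iUnion.2 ⟨k, hk, (Metric.ball_subset_ball hn.le).trans hrU⟩)
  rw [hV0] at hVlim
  obtain ⟨n, hn⟩ := (hVlim.eventually_lt_const (pos_iff_ne_zero.2 hη2)).exists
  refine ⟨1 / ((n : ℝ) + 1), Nat.one_div_pos_of_nat, (V n)ᶜ ∪ ⋃ k, U k \ B k, ?_, ?_⟩
  · calc m ((V n)ᶜ ∪ ⋃ k, U k \ B k) ≤ m (V n)ᶜ + m (⋃ k, U k \ B k) := measure_union_le _ _
      _ ≤ η / 2 + ∑' k, m (U k \ B k) := by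
        gcongr
        exact measure_iUnion_le _
      _ ≤ η / 2 + η / 2 := by
        gcongr
        exact (ENNReal.tsum_le_tsum fun k => (hUm k).le).trans hes.le
      _ = η := ENNReal.add_halves η
  · intro z hz w hw hzw
    simp only [Set.mem_union, not_or, Set.mem_compl_iff, not_not] at hz hw
    obtain ⟨k, hk, hkU⟩ := Set.mem_iUnion.1 hz.1
    have hwU : w ∈ U k := hkU (by rwa [Metric.mem_ball, dist_comm])
    have hwB : w ∈ B k := by
      by_contra hh
      exact hw.2 (Set.mem_iUnion.2 ⟨k, hwU, hh⟩)
    exact hB k z hk w hwB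

theorem GoodSet.bad_cyl (h : GoodSet m T α lam D C g l f u Y) (n : ℕ) (P : Set X)
    {θ : ℝ≥0∞} (h0 : θ ≠ 0) (ht : θ ≠ ⊤) :
    ∃ Z : Set X, m Z ≤ θ⁻¹ * m P ∧ ∀ (w : ℕ → ι) (z : X), z ∈ cyl T α n w → z ∉ Z →
      m (cyl T α n w ∩ P) ≤ θ * m (cyl T α n w) := by
  have := h.ctb
  let c : (Fin n → ι) → Set X := fun w => {x | ∀ k : Fin n, T^[k] x ∈ α (w k)}
  have hcm : ∀ w, MeasurableSet (c w) := by
    intro w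
    have : c w = ⋂ k : Fin n, T^[k] ⁻¹' α (w k) := by
      ext x; simp [c]
    rw [this]
    exact MeasurableSet.iInter fun k => (h.mpT.measurable.iterate k) (h.meas _)
  have hcd : Pairwise (Function.onFun Disjoint c) := by
    intro w w' hww
    rw [Function.onFun, Set.disjoint_left]
    intro x hx hx'
    apply hww
    funext k
    by_contra hk
    exact Set.disjoint_left.1 (h.disj hk) (hx k) (hx' k)
  refine ⟨⋃ w : {w : Fin n → ι // θ * m (c w) < m (c w ∩ P)}, c w, ?_, ?_⟩
  · calc m (⋃ w : {w : Fin n → ι // θ * m (c w) < m (c w ∩ P)}, c w)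
        ≤ ∑' w : {w : Fin n → ι // θ * m (c w) < m (c w ∩ P)}, m (c w) := measure_iUnion_le _
      _ ≤ ∑' w : {w : Fin n → ι // θ * m (c w) < m (c w ∩ P)}, θ⁻¹ * m.restrict P (c w) := by
        refine ENNReal.tsum_le_tsum fun w => ?_
        rw [Measure.restrict_apply (hcm _), ← ENNReal.div_eq_inv_mul,
          ENNReal.le_div_iff_mul_le (Or.inl h0) (Or.inl ht), mul_comm]
        exact w.2.le
      _ ≤ ∑' w : Fin n → ι, θ⁻¹ * m.restrict P (c w) :=
        ENNReal.tsum_comp_le_tsum_of_injective Subtype.val_injective _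
      _ = θ⁻¹ * ∑' w : Fin n → ι, m.restrict P (c w) := ENNReal.tsum_mul_left
      _ ≤ θ⁻¹ * m P := by
        gcongr
        refine (tsum_meas_le_meas_iUnion_of_disjoint _ hcm hcd).trans ?_
        calc m.restrict P (⋃ w, c w) ≤ m.restrict P Set.univ := measure_mono (Set.subset_univ _)
          _ = m P := by simp
  · intro w z hz hzZ
    have hcw : cyl T α n w = c (fun k => w k) := by
      ext x
      exact ⟨fun hx k => hx k k.2, fun hx k hk => hx ⟨k, hk⟩⟩
    rw [hcw] at hz ⊢
    by_contra hh
    exact hzZ (Set.mem_iUnion.2 ⟨⟨fun k => w k, not_le.1 hh⟩, hz⟩)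

theorem GoodSet.concentrate (h : GoodSet m T α lam D C g l f u Y)
    {E : Type*} [PseudoMetricSpace E] {v : X → E} (hv : CovProp m v)
    {ε : ℝ} (hε : 0 < ε) {θ : ℝ≥0∞} (h0 : θ ≠ 0) :
    ∃ n : ℕ, ∃ Z : Set X, m Z ≤ θ ∧ ∀ z ∈ Y, z ∉ Z → ∀ i, T^[n] z ∈ α i →
      ∀ w, z ∈ cyl T α n w →
      ∃ s : Set X, m s ≤ θ ∧ ∀ p ∈ α i, p ∉ s →
        ∃ q ∈ Y, q ∈ cyl T α n w ∧ T^[n] q = p ∧ dist (v q) (v z) ≤ ε := by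
  set K : ℝ := Real.exp (2 * C * D * (1 - lam⁻¹)⁻¹) with hK
  have hKpos : 0 < K := Real.exp_pos _
  set k : ℝ≥0∞ := ENNReal.ofReal K with hk
  have hk0 : k ≠ 0 := by simpa [hk] using hKpos
  have hkt : k ≠ ⊤ := ENNReal.ofReal_ne_top
  -- a small finite parameter
  obtain ⟨t, ht0, htt, htk, htθ⟩ : ∃ t : ℝ≥0∞, t ≠ 0 ∧ t ≠ ⊤ ∧ k * t ≤ θ ∧ t ≤ θ / 2 := by
    refine ⟨min (min (θ / k) (θ / 2)) 1, ?_, ?_, ?_, ?_⟩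
    · simp only [ne_eq, min_eq_iff]
      have h1 : θ / k ≠ 0 := by simp [ENNReal.div_eq_zero_iff, h0, hkt]
      have h2 : θ / 2 ≠ 0 := by simp [ENNReal.div_eq_zero_iff, h0]
      have : 0 < min (min (θ / k) (θ / 2)) 1 :=
        lt_min (lt_min (pos_iff_ne_zero.2 h1) (pos_iff_ne_zero.2 h2)) one_pos
      intro hh
      rcases hh with hh | hh
      · rcases hh.1 with h' | h'
        · exact h1 h'.1
        · exact h2 h'.1
      · exact one_ne_zero hh.1
    · exact ne_top_of_le_ne_top ENNReal.one_ne_top (min_le_right _ _)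
    · calc k * min (min (θ / k) (θ / 2)) 1 ≤ k * (θ / k) := by
            gcongr; exact (min_le_left _ _).trans (min_le_left _ _)
        _ ≤ θ := ENNReal.mul_div_le
    · exact (min_le_left _ _).trans (min_le_right _ _)
  have htt2 : t * t ≠ 0 := mul_ne_zero ht0 ht0
  obtain ⟨δ, hδ, P, hP, hPosc⟩ := lusin_osc (m := m) hv hε
    (η := min (θ / 2) (t * t)) (by
      have h2 : θ / 2 ≠ 0 := by simp [ENNReal.div_eq_zero_iff, h0]
      exact (lt_min (pos_iff_ne_zero.2 h2) (pos_iff_ne_zero.2 htt2)).ne')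
  have hl : lam⁻¹ < 1 := inv_lt_one_of_one_lt₀ h.hlam
  have hl0 : 0 ≤ lam⁻¹ := (inv_pos.2 (one_pos.trans h.hlam)).le
  obtain ⟨n, hn⟩ : ∃ n : ℕ, (lam⁻¹) ^ n * D < δ := by
    have h1 : Tendsto (fun n : ℕ => (lam⁻¹) ^ n * D) atTop (nhds (0 * D)) :=
      (tendsto_pow_atTop_nhds_zero_of_lt_one hl0 hl).mul_const D
    rw [zero_mul] at h1
    exact (h1.eventually_lt_const hδ).exists
  obtain ⟨Z, hZ, hZc⟩ := h.bad_cyl n P ht0 htt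
  refine ⟨n, P ∪ Z, ?_, ?_⟩
  · calc m (P ∪ Z) ≤ m P + m Z := measure_union_le _ _
      _ ≤ θ / 2 + θ / 2 := by
        gcongr
        · exact hP.trans (min_le_left _ _)
        · refine hZ.trans (le_trans ?_ htθ)
          calc t⁻¹ * m P ≤ t⁻¹ * (t * t) := by
                gcongr; exact hP.trans (min_le_right _ _)
            _ = t := by rw [← mul_assoc, ENNReal.inv_mul_cancel ht0 htt, one_mul]
      _ = θ := ENNReal.add_halves θ
  · intro z hz hzPZ i hzi w hzc
    simp only [Set.mem_union, not_or] at hzPZ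
    set Q := (cyl T α n w ∩ P) ∩ Y with hQ
    have hpos := h.cyl_pos hz hzc hzi
    have hfin : m (cyl T α n w) ≠ ⊤ := measure_ne_top _ _
    refine ⟨T^[n] '' Q ∪ (α i \ T^[n] '' (cyl T α n w ∩ Y)), ?_, ?_⟩
    · refine (measure_union_le _ _).trans ?_
      rw [h.surj n w z i hz hzc hzi, add_zero]
      refine (ENNReal.mul_le_mul_iff_left hpos hfin).1 ?_
      calc m (T^[n] '' Q) * m (cyl T α n w)
          ≤ ENNReal.ofReal (Real.exp (Kd lam D C n)) * m Q :=
            h.distortion n w z Q hz hzc Set.inter_subset_right (fun x hx => hx.1.1)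
        _ ≤ k * m (cyl T α n w ∩ P) := by
          gcongr
          · exact ENNReal.ofReal_le_ofReal (Real.exp_le_exp.2 (h.Kd_le n))
          · exact Set.inter_subset_left
        _ ≤ k * (t * m (cyl T α n w)) := by
          gcongr
          exact hZc w z hzc hzPZ.2
        _ = (k * t) * m (cyl T α n w) := by ring
        _ ≤ θ * m (cyl T α n w) := by gcongr
    · intro p hp hps
      simp only [Set.mem_union, not_or] at hps
      have hpi : p ∈ T^[n] '' (cyl T α n w ∩ Y) := by
        by_contra hh
        exact hps.2 ⟨hp, hh⟩
      obtain ⟨q, ⟨hqc, hqY⟩, rfl⟩ := hpi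
      have hqP : q ∉ P := fun hqP => hps.1 ⟨q, ⟨⟨hqc, hqP⟩, hqY⟩, rfl⟩
      refine ⟨q, hqY, hqc, rfl, hPosc q hqP z hzPZ.1 ?_⟩
      exact (h.dist_cyl n w q z hqY hz hqc hzc).trans_lt hn

theorem GoodSet.itin (h : GoodSet m T α lam D C g l f u Y) {z : X} (hz : z ∈ Y) :
    ∃ w : ℕ → ι, ∀ n, z ∈ cyl T α n w := by
  choose w hw using fun n => h.cov _ (h.iter_mem n z hz)
  exact ⟨w, fun n k _ => hw k⟩

theorem GoodSet.inv_set (h : GoodSet m T α lam D C g l f u Y) {B : Set X} (hB : MeasurableSet B)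
    (hinv : ∀ x ∈ Y, (x ∈ B ↔ T x ∈ B)) {i : ι} (hi : m (B ∩ α i) ≠ 0) : m (α i \ B) = 0 := by
  classical
  have hiter : ∀ n, ∀ x ∈ Y, (x ∈ B ↔ T^[n] x ∈ B) := by
    intro n
    induction n with
    | zero => intro x _; rfl
    | succ n ih =>
      intro x hx
      rw [hinv x hx]
      exact ih (T x) (h.maps x hx)
  let v : X → ℝ := B.indicator fun _ => 1
  have hv : CovProp m v := by
    intro ε hε
    refine ⟨fun k => if k = 0 then B else Bᶜ, ?_, ?_, ?_⟩
    · intro k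
      dsimp only
      split_ifs
      · exact hB
      · exact hB.compl
    · have : (⋃ k : ℕ, if k = 0 then B else Bᶜ) = Set.univ := by
        ext x
        simp only [Set.mem_iUnion, Set.mem_univ, iff_true]
        by_cases hx : x ∈ B
        · exact ⟨0, by simpa using hx⟩
        · exact ⟨1, by simpa using hx⟩
      rw [this]; simp
    · intro k x hx y hy
      dsimp only at hx hy
      split_ifs at hx hy with hk
      · simp [v, hx, hy, hε.le]
      · have hx' : x ∉ B := hx
        have hy' : y ∉ B := hy
        simp [v, hx', hy', hε.le]
  have key : ∀ θ : ℝ≥0∞, 0 < θ → m (α i \ B) ≤ θ := by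
    intro θ hθ
    have hi2 : m (B ∩ α i) / 2 ≠ 0 := by simpa using hi
    have hmin : min θ (m (B ∩ α i) / 2) ≠ 0 := (lt_min hθ (pos_iff_ne_zero.2 hi2)).ne'
    obtain ⟨n, Z, hZ, hc⟩ := h.concentrate hv (ε := 1 / 2) (by norm_num) hmin
    have hex : ∃ z ∈ Y, z ∉ Z ∧ T^[n] z ∈ B ∩ α i := by
      by_contra! hh
      have h1 : T^[n] ⁻¹' (B ∩ α i) ⊆ Z ∪ Yᶜ := by
        intro z hz
        by_cases hzY : z ∈ Y
        · left
          by_contra hzZ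
          exact hh z hzY hzZ hz
        · exact Or.inr hzY
      have h2 := (h.mpT.iterate n).measure_preimage (hB.inter (h.meas i)).nullMeasurableSet
      have h3 : m (B ∩ α i) ≤ m (B ∩ α i) / 2 := by
        calc m (B ∩ α i) = m (T^[n] ⁻¹' (B ∩ α i)) := h2.symm
          _ ≤ m (Z ∪ Yᶜ) := measure_mono h1
          _ ≤ m Z + m Yᶜ := measure_union_le _ _
          _ = m Z := by rw [h.conull, add_zero]
          _ ≤ _ := hZ.trans (min_le_right _ _)
      exact absurd h3 (not_le.2 (ENNReal.half_lt_self hi (measure_ne_top _ _)))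
    obtain ⟨z, hzY, hzZ, hzB, hzi⟩ := hex
    obtain ⟨w, hw⟩ := h.itin hzY
    obtain ⟨s, hs, hsp⟩ := hc z hzY hzZ i hzi w (hw n)
    refine le_trans (measure_mono ?_) (hs.trans (min_le_left _ _))
    rintro p ⟨hpi, hpB⟩
    by_contra hps
    obtain ⟨q, hqY, _, rfl, hd⟩ := hsp p hpi hps
    have hqB : q ∉ B := fun hq => hpB ((hiter n q hqY).1 hq)
    have hzB' : z ∈ B := (hiter n z hzY).2 hzB
    simp only [v, Set.indicator_of_mem hzB', Set.indicator_of_notMem hqB] at hd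
    norm_num [Real.dist_eq] at hd
  by_contra hne
  have h1 := key _ (ENNReal.half_pos hne)
  exact absurd h1 (not_le.2 (ENNReal.half_lt_self hne (measure_ne_top _ _)))

theorem GoodSet.separable (h : GoodSet m T α lam D C g l f u Y) :
    TopologicalSpace.IsSeparable Y := by
  classical
  have := h.ctb
  let c : (Σ n : ℕ, Fin n → ι) → Set X := fun w => {x | x ∈ Y ∧ ∀ k : Fin w.1, T^[k] x ∈ α (w.2 k)}
  let D0 : Set X := Set.range fun w : {w // (c w).Nonempty} => w.2.some
  refine ⟨D0, Set.countable_range _, ?_⟩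
  intro y hy
  rw [Metric.mem_closure_iff]
  intro ε hε
  have hl : lam⁻¹ < 1 := inv_lt_one_of_one_lt₀ h.hlam
  have hl0 : 0 ≤ lam⁻¹ := (inv_pos.2 (one_pos.trans h.hlam)).le
  obtain ⟨n, hn⟩ : ∃ n : ℕ, (lam⁻¹) ^ n * D < ε := by
    have h1 : Tendsto (fun n : ℕ => (lam⁻¹) ^ n * D) atTop (nhds (0 * D)) :=
      (tendsto_pow_atTop_nhds_zero_of_lt_one hl0 hl).mul_const D
    rw [zero_mul] at h1
    exact (h1.eventually_lt_const hε).exists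
  obtain ⟨w, hw⟩ := h.itin hy
  have hne : (c ⟨n, fun k => w k⟩).Nonempty := ⟨y, hy, fun k => hw n k k.2⟩
  refine ⟨hne.some, ⟨⟨_, hne⟩, rfl⟩, ?_⟩
  have h1 := hne.some_mem
  refine (h.dist_cyl n w _ _ hy h1.1 (hw n) ?_).trans_lt hn
  exact fun k hk => h1.2 ⟨k, hk⟩

theorem dist_add_le_of_inv (hinv : ∀ g x y : G, dist (g + x) (g + y) = dist x y) (a b c d : G) :
    dist (a + b) (c + d) ≤ dist a c + dist b d := by
  calc dist (a + b) (c + d) ≤ dist (a + b) (c + b) + dist (c + b) (c + d) := dist_triangle _ _ _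
    _ = dist a c + dist b d := by rw [hinv, add_comm a b, add_comm c b, hinv]

theorem dist_neg_of_inv (hinv : ∀ g x y : G, dist (g + x) (g + y) = dist x y) (a b : G) :
    dist (-a) (-b) = dist a b := by
  rw [← hinv (a + b) (-a) (-b), dist_comm a b]
  congr 1 <;> abel

theorem topGroup_of_inv (hinv : ∀ g x y : G, dist (g + x) (g + y) = dist x y) :
    IsTopologicalAddGroup G where
  continuous_add := by
    refine (LipschitzWith.of_dist_le_mul (K := 2) ?_).continuous
    intro p q
    refine (dist_add_le_of_inv hinv _ _ _ _).trans ?_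
    have h1 : dist p.1 q.1 ≤ dist p q := le_max_left _ _
    have h2 : dist p.2 q.2 ≤ dist p q := le_max_right _ _
    push_cast
    linarith
  continuous_neg := (Isometry.of_dist_eq (dist_neg_of_inv hinv)).continuous

theorem GoodSet.covProp [MeasurableSpace G] [BorelSpace G] [LocallyCompactSpace G]
    (h : GoodSet m T α lam D C g l f u Y)
    (hinv : ∀ g x y : G, dist (g + x) (g + y) = dist x y) (hu : Measurable u)
    (hlt : ∀ i, l i ≠ ⊤) : CovProp m u := by
  classical
  have := h.ctb
  have hG := topGroup_of_inv hinv
  have hYsep := h.separable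
  -- separability of the range of f
  have hfsep : TopologicalSpace.IsSeparable (f '' Y) := by
    have h1 : f '' Y ⊆ ⋃ i, f '' (Y ∩ α i) := by
      rintro _ ⟨x, hx, rfl⟩
      obtain ⟨i, hi⟩ := h.cov x hx
      exact Set.mem_iUnion.2 ⟨i, x, ⟨hx, hi⟩, rfl⟩
    refine TopologicalSpace.IsSeparable.mono (.iUnion fun i => ?_) h1
    refine ContinuousOn.isSeparable_image ?_ (hYsep.mono Set.inter_subset_left)
    have : LipschitzOnWith (l i).toNNReal f (Y ∩ α i) := by
      intro x hx y hy
      rw [ENNReal.coe_toNNReal (hlt i)]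
      exact h.lip i x hx.1 hx.2 y hy.1 hy.2
    exact this.continuousOn
  obtain ⟨N, hNc, hN⟩ := exists_compact_mem_nhds (0 : G)
  let H : Submodule ℤ G := Submodule.span ℤ (N ∪ f '' Y)
  have hHsep : TopologicalSpace.IsSeparable (H : Set G) :=
    (hNc.isSeparable.union hfsep).span
  have hHopen : IsOpen (H : Set G) := by
    refine H.toAddSubgroup.isOpen_of_mem_nhds (g := 0) ?_
    exact Filter.mem_of_superset hN (fun x hx => Submodule.subset_span (Or.inl hx))
  have hfH : ∀ x ∈ Y, f x ∈ H := fun x hx => Submodule.subset_span (Or.inr ⟨x, hx, rfl⟩)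
  let π : X → G ⧸ H := fun x => Submodule.Quotient.mk (u x)
  have hπT : ∀ x ∈ Y, π (T x) = π x := by
    intro x hx
    refine (Submodule.Quotient.eq H).2 ?_
    rw [h.cob x hx]
    have : u x - f x - u x = - f x := by abel
    rw [this]
    exact H.neg_mem (hfH x hx)
  have hmeas : ∀ E : Set (G ⧸ H), MeasurableSet (π ⁻¹' E) := by
    intro E
    have ho : IsOpen ((Submodule.Quotient.mk : G → G ⧸ H) ⁻¹' E) := by
      have : (Submodule.Quotient.mk : G → G ⧸ H) ⁻¹' E =
          ⋃ a ∈ (Submodule.Quotient.mk : G → G ⧸ H) ⁻¹' E, (fun x => x - a) ⁻¹' (H : Set G) := by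
        ext x
        simp only [Set.mem_iUnion]
        constructor
        · intro hx
          exact ⟨x, hx, by simp⟩
        · rintro ⟨a, ha, hxa⟩
          have : (Submodule.Quotient.mk x : G ⧸ H) = Submodule.Quotient.mk a :=
            (Submodule.Quotient.eq H).2 hxa
          rw [Set.mem_preimage, this]
          exact ha
      rw [this]
      exact isOpen_biUnion fun a _ => hHopen.preimage (continuous_id.sub continuous_const)
    exact hu ho.measurableSet
  have hdich : ∀ (E : Set (G ⧸ H)) (i : ι),
      m (π ⁻¹' E ∩ α i) = 0 ∨ m (α i \ π ⁻¹' E) = 0 := by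
    intro E i
    by_cases h0 : m (π ⁻¹' E ∩ α i) = 0
    · exact Or.inl h0
    · refine Or.inr (h.inv_set (hmeas E) ?_ h0)
      intro x hx
      simp only [Set.mem_preimage, hπT x hx]
  -- π is a.e. constant on each α i
  have hconst : ∀ i, ∃ q : G ⧸ H, ∀ᵐ x ∂m, x ∈ α i → π x = q := by
    intro i
    have hsc : SecondCountableTopology Y := hYsep.secondCountableTopology
    have hsec : ∀ q : π '' Y, ∃ y : Y, π y = q := by
      rintro ⟨_, x, hx, rfl⟩
      exact ⟨⟨x, hx⟩, rfl⟩
    choose s hs using hsec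
    let b := TopologicalSpace.countableBasis Y
    have hb := TopologicalSpace.isBasis_countableBasis Y
    have hbc : b.Countable := TopologicalSpace.countable_countableBasis Y
    have hbcc : Countable b := hbc.to_subtype
    let E : b → Set (G ⧸ H) := fun O => {q | ∃ hq : q ∈ π '' Y, s ⟨q, hq⟩ ∈ O.1}
    have hall : ∀ O : b, ∃ c : Prop, ∀ᵐ x ∂m, x ∈ α i → (π x ∈ E O ↔ c) := by
      intro O
      rcases hdich (E O) i with h0 | h0
      · refine ⟨False, ?_⟩
        filter_upwards [measure_eq_zero_iff_ae_notMem.1 h0] with x hx hxi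
        exact iff_of_false (fun hh => hx ⟨hh, hxi⟩) id
      · refine ⟨True, ?_⟩
        filter_upwards [measure_eq_zero_iff_ae_notMem.1 h0] with x hx hxi
        refine iff_of_true ?_ trivial
        by_contra hh
        exact hx ⟨hxi, hh⟩
    choose c hc using hall
    have hY : ∀ᵐ x ∂m, x ∈ Y := by
      filter_upwards [measure_eq_zero_iff_ae_notMem.1 h.conull] with x hx
      simpa using hx
    have hgood : ∀ᵐ x ∂m, x ∈ Y ∧ ∀ O : b, x ∈ α i → (π x ∈ E O ↔ c O) := by
      filter_upwards [hY, ae_all_iff.2 hc] with x h1 h2 using ⟨h1, h2⟩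
    obtain ⟨x0, hx0i, hx0Y, hx0⟩ : ∃ x0, x0 ∈ α i ∧ x0 ∈ Y ∧
        ∀ O : b, x0 ∈ α i → (π x0 ∈ E O ↔ c O) := by
      by_contra! hh
      refine (h.pos i).ne' (measure_mono_null ?_ hgood)
      intro x hxi hx
      obtain ⟨O, hO1, hO2⟩ := hh x hxi hx.1
      have := hx.2 O hxi
      tauto
    refine ⟨π x0, ?_⟩
    filter_upwards [hgood] with x hx hxi
    have e1 : s ⟨π x, x, hx.1, rfl⟩ = s ⟨π x0, x0, hx0Y, rfl⟩ := by
      rw [hb.eq_iff]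
      intro O hO
      have h1 := (hx.2 ⟨O, hO⟩ hxi).trans (hx0 ⟨O, hO⟩ hx0i).symm
      constructor
      · intro hh
        obtain ⟨_, h3⟩ := h1.1 ⟨⟨x, hx.1, rfl⟩, hh⟩
        exact h3
      · intro hh
        obtain ⟨_, h3⟩ := h1.2 ⟨⟨x0, hx0Y, rfl⟩, hh⟩
        exact h3
    have e2 := hs ⟨π x, x, hx.1, rfl⟩
    have e3 := hs ⟨π x0, x0, hx0Y, rfl⟩
    rw [e1] at e2
    exact e2.symm.trans e3
  choose q hq using hconst
  have hrep : ∀ i, ∃ a : G, (Submodule.Quotient.mk a : G ⧸ H) = q i := fun i =>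
    Submodule.Quotient.mk_surjective H (q i)
  choose a ha using hrep
  let S : Set G := ⋃ i, (fun x => a i + x) '' (H : Set G)
  have hSsep : TopologicalSpace.IsSeparable S :=
    .iUnion fun i => hHsep.image (continuous_const.add continuous_id)
  have huS : ∀ᵐ x ∂m, u x ∈ S := by
    filter_upwards [measure_eq_zero_iff_ae_notMem.1 h.conull, ae_all_iff.2 hq] with x hx1 hx2
    have hxY : x ∈ Y := by simpa using hx1
    obtain ⟨i, hi⟩ := h.cov x hxY
    have h1 : π x = _ := hx2 i hi
    rw [← ha i] at h1
    have h2 : u x - a i ∈ H := (Submodule.Quotient.eq H).1 h1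
    exact Set.mem_iUnion.2 ⟨i, _, h2, by simp⟩
  obtain ⟨c, hcc, hcS⟩ := hSsep
  intro ε hε
  have hcne : c.Nonempty := by
    by_contra hh
    rw [Set.not_nonempty_iff_eq_empty] at hh
    rw [hh, closure_empty, Set.subset_empty_iff] at hcS
    have := huS.exists
    rw [hcS] at this
    simp at this
  obtain ⟨e, rfl⟩ := hcc.exists_eq_range hcne
  refine ⟨fun k => u ⁻¹' Metric.ball (e k) (ε / 2), fun k => hu measurableSet_ball, ?_, ?_⟩
  · refine measure_mono_null ?_ huS
    intro x hx hxS
    obtain ⟨_, ⟨k, rfl⟩, hk⟩ := Metric.mem_closure_iff.1 (hcS hxS) (ε / 2) (by positivity)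
    exact hx (Set.mem_iUnion.2 ⟨k, hk⟩)
  · intro k x hx y hy
    have h1 : dist (u x) (e k) < ε / 2 := hx
    have h2 : dist (u y) (e k) < ε / 2 := hy
    have := dist_triangle_right (u x) (u y) (e k)
    linarith

theorem edist_sub_le_of_inv (hinv : ∀ g x y : G, dist (g + x) (g + y) = dist x y) (a b c d : G) :
    edist (a - b) (c - d) ≤ edist a c + edist b d := by
  have h1 := dist_add_le_of_inv hinv a (-b) c (-d)
  rw [dist_neg_of_inv hinv] at h1
  rw [sub_eq_add_neg, sub_eq_add_neg, edist_dist, edist_dist a c, edist_dist b d,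
    ← ENNReal.ofReal_add dist_nonneg dist_nonneg]
  exact ENNReal.ofReal_le_ofReal h1

/-- The function equal to `l i` on `α i`. -/
noncomputable def Lf (α : ι → Set X) (l : ι → ℝ≥0∞) (x : X) : ℝ≥0∞ :=
  ∑' i, (α i).indicator (fun _ => l i) x

/-- Accumulated Lipschitz constants along an orbit. -/
noncomputable def Wf (T : X → X) (α : ι → Set X) (lam : ℝ) (l : ι → ℝ≥0∞) : ℕ → X → ℝ≥0∞
  | 0 => fun _ => 0
  | n + 1 => fun z => ENNReal.ofReal lam⁻¹ * (Wf T α lam l n z + Lf α l (T^[n] z))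

theorem GoodSet.edist_expand (h : GoodSet m T α lam D C g l f u Y) {i : ι} {x y : X}
    (hx : x ∈ Y) (hxi : x ∈ α i) (hy : y ∈ Y) (hyi : y ∈ α i) :
    edist x y ≤ ENNReal.ofReal lam⁻¹ * edist (T x) (T y) := by
  have hl : 0 < lam := one_pos.trans h.hlam
  rw [edist_dist, edist_dist, ← ENNReal.ofReal_mul (inv_nonneg.2 hl.le)]
  apply ENNReal.ofReal_le_ofReal
  rw [← div_eq_inv_mul, le_div_iff₀ hl, mul_comm]
  exact h.expand i x hx hxi y hy hyi

theorem GoodSet.edist_iter (h : GoodSet m T α lam D C g l f u Y)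
    (hinv : ∀ g x y : G, dist (g + x) (g + y) = dist x y) (n : ℕ) (w : ℕ → ι) (z p q : X)
    (hp : p ∈ Y) (hq : q ∈ Y) (hzc : z ∈ cyl T α n w) (hpc : p ∈ cyl T α n w)
    (hqc : q ∈ cyl T α n w) :
    edist (u (T^[n] p)) (u (T^[n] q)) ≤
      edist (u p) (u q) + Wf T α lam l n z * edist (T^[n] p) (T^[n] q) := by
  induction n with
  | zero => simp
  | succ n ih =>
    rw [cyl_succ_iff'] at hzc hpc hqc
    have h1 := ih hzc.1 hpc.1 hqc.1
    simp only [Function.iterate_succ_apply']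
    have hP := h.iter_mem n p hp
    have hQ := h.iter_mem n q hq
    set P := T^[n] p
    set Q := T^[n] q
    have h2 := h.edist_expand hP hpc.2 hQ hqc.2
    have h3 := h.lip _ P hP hpc.2 Q hQ hqc.2
    have h4 : l (w n) ≤ Lf α l (T^[n] z) := by
      have := ENNReal.le_tsum (f := fun i => (α i).indicator (fun _ => l i) (T^[n] z)) (w n)
      rwa [Set.indicator_of_mem hzc.2] at this
    rw [h.cob P hP, h.cob Q hQ]
    calc edist (u P - f P) (u Q - f Q) ≤ edist (u P) (u Q) + edist (f P) (f Q) :=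
          edist_sub_le_of_inv hinv _ _ _ _
      _ ≤ (edist (u p) (u q) + Wf T α lam l n z * edist P Q) +
          Lf α l (T^[n] z) * edist P Q := by
        gcongr
        exact h3.trans (by gcongr)
      _ = edist (u p) (u q) + (Wf T α lam l n z + Lf α l (T^[n] z)) * edist P Q := by ring
      _ ≤ edist (u p) (u q) + (Wf T α lam l n z + Lf α l (T^[n] z)) *
          (ENNReal.ofReal lam⁻¹ * edist (T P) (T Q)) := by gcongr
      _ = _ := by rw [Wf]; ring

theorem GoodSet.meas_Lf (h : GoodSet m T α lam D C g l f u Y) : Measurable (Lf α l) := by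
  have := h.ctb
  unfold Lf
  exact Measurable.ennreal_tsum fun i => measurable_const.indicator (h.meas i)

theorem GoodSet.meas_Wf (h : GoodSet m T α lam D C g l f u Y) (n : ℕ) :
    Measurable (Wf T α lam l n) := by
  induction n with
  | zero => exact measurable_const
  | succ n ih =>
    exact (ih.add (h.meas_Lf.comp (h.mpT.measurable.iterate n))).const_mul _

theorem GoodSet.lintegral_Wf (h : GoodSet m T α lam D C g l f u Y) (n : ℕ) :
    ∫⁻ z, Wf T α lam l n z ∂m ≤
      ENNReal.ofReal (lam - 1)⁻¹ * ∑' i, m (α i) * l i := by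
  have := h.ctb
  have hlam := h.hlam
  have hI : ∫⁻ z, Lf α l z ∂m = ∑' i, m (α i) * l i := by
    unfold Lf
    rw [lintegral_tsum fun i => (measurable_const.indicator (h.meas i)).aemeasurable]
    congr 1
    funext i
    rw [lintegral_indicator_const (h.meas i), mul_comm]
  induction n with
  | zero => simp [Wf]
  | succ n ih =>
    simp only [Wf]
    have hm : Measurable fun z => Lf α l (T^[n] z) :=
      h.meas_Lf.comp (h.mpT.measurable.iterate n)
    rw [lintegral_const_mul _ (show Measurable fun z => Wf T α lam l n z + Lf α l (T^[n] z) from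
        (h.meas_Wf n).add hm), lintegral_add_right _ hm,
      (h.mpT.iterate n).lintegral_comp h.meas_Lf, hI]
    set I := ∑' i, m (α i) * l i
    calc ENNReal.ofReal lam⁻¹ * (∫⁻ z, Wf T α lam l n z ∂m + I)
        ≤ ENNReal.ofReal lam⁻¹ * (ENNReal.ofReal (lam - 1)⁻¹ * I + I) := by gcongr
      _ = ENNReal.ofReal lam⁻¹ * (ENNReal.ofReal (lam - 1)⁻¹ + ENNReal.ofReal 1) * I := by
        rw [ENNReal.ofReal_one]; ring
      _ = ENNReal.ofReal (lam - 1)⁻¹ * I := by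
        have h1 : 0 < lam - 1 := by linarith
        have h2 : 0 < lam := by linarith
        rw [← ENNReal.ofReal_add (inv_nonneg.2 h1.le) zero_le_one,
          ← ENNReal.ofReal_mul (inv_nonneg.2 h2.le)]
        congr 2
        field_simp
        ring

theorem GoodSet.lip_u (h : GoodSet m T α lam D C g l f u Y)
    (hinv : ∀ g x y : G, dist (g + x) (g + y) = dist x y) (hu : CovProp m u)
    (hl : ∑' i, m (α i) * l i ≠ ⊤) (i : ι) :
    ∃ K : ℝ≥0∞, K ≠ ⊤ ∧ ∃ Ω : Set X, Ω ⊆ α i ∧ m (α i \ Ω) = 0 ∧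
      ∀ x ∈ Ω, ∀ y ∈ Ω, edist (u x) (u y) ≤ K * edist x y := by
  set I := ENNReal.ofReal (lam - 1)⁻¹ * ∑' i, m (α i) * l i with hI
  have hIt : I ≠ ⊤ := ENNReal.mul_ne_top ENNReal.ofReal_ne_top hl
  set a := m (α i) with ha
  have ha0 : a ≠ 0 := (h.pos i).ne'
  have hat : a ≠ ⊤ := measure_ne_top _ _
  have ha2 : a / 2 ≠ 0 := by simpa using ha0
  have ha2t : a / 2 ≠ ⊤ := (ENNReal.half_lt_self ha0 hat).ne_top
  have ha4 : a / 2 / 2 ≠ 0 := by simpa using ha0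
  set M := I / (a / 2) + 1 with hM
  have hMt : M ≠ ⊤ := ENNReal.add_ne_top.2 ⟨ENNReal.div_ne_top hIt ha2, ENNReal.one_ne_top⟩
  have hM0 : M ≠ 0 := by simp [hM]
  have hMI : I ≤ M * (a / 2) := by
    rw [hM, add_mul, ENNReal.div_mul_cancel ha2 ha2t]
    exact le_self_add
  have hW : ∀ n, m {z | M ≤ Wf T α lam l n z} ≤ a / 2 := by
    intro n
    refine (ENNReal.mul_le_mul_iff_right hM0 hMt).1 ?_
    exact (mul_meas_ge_le_lintegral (h.meas_Wf n) M).trans ((h.lintegral_Wf n).trans hMI)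
  have key : ∀ j : ℕ, ∃ s : Set X, m s ≤ (2⁻¹ : ℝ≥0∞) ^ j ∧ ∀ p ∈ α i, p ∉ s →
      ∀ p' ∈ α i, p' ∉ s →
      edist (u p) (u p') ≤ ENNReal.ofReal (2 * (1 / 2 : ℝ) ^ j) + M * edist p p' := by
    intro j
    have hθ : min ((2⁻¹ : ℝ≥0∞) ^ j) (a / 2 / 2) ≠ 0 := by
      refine (lt_min ?_ (pos_iff_ne_zero.2 ha4)).ne'
      exact ENNReal.pow_pos (by simp) j
    obtain ⟨n, Z, hZ, hc⟩ := h.concentrate hu (ε := (1 / 2 : ℝ) ^ j) (by positivity) hθ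
    have hex : ∃ z ∈ Y, z ∉ Z ∧ T^[n] z ∈ α i ∧ Wf T α lam l n z ≤ M := by
      by_contra! hh
      have h1 : T^[n] ⁻¹' (α i) ⊆ (Z ∪ {z | M ≤ Wf T α lam l n z}) ∪ Yᶜ := by
        intro z hz
        by_cases hzY : z ∈ Y
        · left
          by_cases hzZ : z ∈ Z
          · exact Or.inl hzZ
          · exact Or.inr (hh z hzY hzZ hz).le
        · exact Or.inr hzY
      have h2 := (h.mpT.iterate n).measure_preimage (h.meas i).nullMeasurableSet
      have h3 : a ≤ a / 2 / 2 + a / 2 := by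
        calc a = m (T^[n] ⁻¹' (α i)) := h2.symm
          _ ≤ m ((Z ∪ {z | M ≤ Wf T α lam l n z}) ∪ Yᶜ) := measure_mono h1
          _ ≤ m (Z ∪ {z | M ≤ Wf T α lam l n z}) + m Yᶜ := measure_union_le _ _
          _ = m (Z ∪ {z | M ≤ Wf T α lam l n z}) := by rw [h.conull, add_zero]
          _ ≤ m Z + m {z | M ≤ Wf T α lam l n z} := measure_union_le _ _
          _ ≤ _ := add_le_add (hZ.trans (min_le_right _ _)) (hW n)
      have h4 : a / 2 / 2 + a / 2 < a / 2 + a / 2 :=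
        ENNReal.add_lt_add_right ha2t (ENNReal.half_lt_self ha2 ha2t)
      rw [ENNReal.add_halves] at h4
      exact absurd h3 (not_le.2 h4)
    obtain ⟨z, hzY, hzZ, hzi, hzW⟩ := hex
    obtain ⟨w, hw⟩ := h.itin hzY
    obtain ⟨s, hs, hsp⟩ := hc z hzY hzZ i hzi w (hw n)
    refine ⟨s, hs.trans (min_le_left _ _), ?_⟩
    intro p hp hps p' hp' hps'
    obtain ⟨q, hqY, hqc, rfl, hqd⟩ := hsp p hp hps
    obtain ⟨q', hqY', hqc', rfl, hqd'⟩ := hsp p' hp' hps'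
    refine (h.edist_iter hinv n w z q q' hqY hqY' (hw n) hqc hqc').trans ?_
    gcongr
    rw [edist_dist]
    apply ENNReal.ofReal_le_ofReal
    have := dist_triangle_right (u q) (u q') (u z)
    linarith
  choose s hs hsl using key
  have hsum : ∑' j, m (s j) ≠ ⊤ := by
    refine ne_top_of_le_ne_top ?_ (ENNReal.tsum_le_tsum hs)
    rw [ENNReal.tsum_geometric, ENNReal.one_sub_inv_two, inv_inv]
    exact ENNReal.ofNat_ne_top
  have hae := ae_eventually_notMem hsum
  refine ⟨M, hMt, {x | x ∈ α i ∧ ∀ᶠ j in atTop, x ∉ s j}, fun x hx => hx.1, ?_, ?_⟩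
  · refine measure_mono_null ?_ hae
    rintro x ⟨hx, hx2⟩ hx3
    exact hx2 ⟨hx, hx3⟩
  · rintro x ⟨hxi, hx⟩ y ⟨hyi, hy⟩
    have hlim : Tendsto (fun j : ℕ => ENNReal.ofReal (2 * (1 / 2 : ℝ) ^ j) + M * edist x y) atTop
        (nhds (ENNReal.ofReal (2 * 0) + M * edist x y)) := by
      refine Tendsto.add_const _ ?_
      refine ENNReal.tendsto_ofReal ?_
      exact (_root_.tendsto_pow_atTop_nhds_zero_of_lt_one (r := (1 / 2 : ℝ)) (by norm_num) (by norm_num)).const_mul 2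
    rw [mul_zero, ENNReal.ofReal_zero, zero_add] at hlim
    refine ge_of_tendsto hlim ?_
    filter_upwards [hx, hy] with j h1 h2
    exact hsl j x hxi h1 y hyi h2

end dyn

/-- Livšic regularity for Gibbs-Markov maps: if `f = u - u ∘ T` a.e., with
`∑ m(a) Df(a) < ∞`, then `sup_{a* ∈ α*} Du(a*) < ∞` and `u` is essentially bounded. -/
theorem livsic_regularity_gibbs_markov
    [MetricSpace X] [MeasurableSpace X] [BorelSpace X]
    [MetricSpace G] [AddCommGroup G] [MeasurableSpace G] [BorelSpace G]
    [LocallyCompactSpace G]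
    (hinv : ∀ g x y : G, dist (g + x) (g + y) = dist x y)
    (m : Measure X) [IsProbabilityMeasure m]
    (T : X → X) (hpres : MeasurePreserving T m m)
    (α : ι → Set X) (lam : ℝ) (hGM : GibbsMarkov m T α lam)
    (f u : X → G) (hu : Measurable u)
    (hf : ∑' i, m (α i) * essLip m f (α i) ≠ ⊤)
    (hcob : ∀ᵐ x ∂m, f x = u x - u (T x)) :
    (∃ K : ℝ≥0∞, K ≠ ⊤ ∧ ∀ A : Set X, isImageAtom T α A → essLip m u A ≤ K) ∧
    (∃ M : ℝ, ∀ᵐ x ∂m, dist (u x) 0 ≤ M) := by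
  classical
  obtain ⟨D, C, g, l, Y, h, hl⟩ := exists_goodSet m T hpres α lam hGM f u hf hcob
  have hctb := h.ctb
  have hlt : ∀ i, l i ≠ ⊤ := by
    intro i hi
    have := ENNReal.ne_top_of_tsum_ne_top hl i
    rw [hi, ENNReal.mul_top (hGM.pos i).ne'] at this
    exact this rfl
  have hcov := h.covProp hinv hu hlt
  choose K hK Ω hΩa hΩn hΩ using h.lip_u hinv hcov hl
  obtain ⟨F, hF⟩ := hGM.bip
  let R : ι → Set X := fun i => T '' (Ω i ∩ Y)
  have hRn : ∀ i, m (T '' α i \ R i) = 0 := by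
    intro i
    have h1 : m (α i \ (Ω i ∩ Y)) = 0 := by
      refine measure_mono_null ?_ (measure_union_null (hΩn i) h.conull)
      rintro x ⟨hx1, hx2⟩
      by_cases hxY : x ∈ Y
      · exact Or.inl ⟨hx1, fun hh => hx2 ⟨hh, hxY⟩⟩
      · exact Or.inr hxY
    have h2 := image_null m T (α i) (h.meas i) g (h.jac i) _ Set.sdiff_subset h1
    refine measure_mono_null ?_ h2
    rintro _ ⟨⟨x, hx, rfl⟩, hx2⟩
    exact ⟨x, ⟨hx, fun hh => hx2 ⟨x, hh, rfl⟩⟩, rfl⟩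
  have hRl : ∀ i, ∀ x ∈ R i, ∀ y ∈ R i, edist (u x) (u y) ≤ (K i + l i) * edist x y := by
    rintro i _ ⟨x, ⟨hx, hxY⟩, rfl⟩ _ ⟨y, ⟨hy, hyY⟩, rfl⟩
    rw [h.cob x hxY, h.cob y hyY]
    have h1 : edist x y ≤ edist (T x) (T y) := by
      refine (h.edist_expand hxY (hΩa i hx) hyY (hΩa i hy)).trans ?_
      have : ENNReal.ofReal lam⁻¹ ≤ 1 :=
        ENNReal.ofReal_le_one.2 (inv_le_one_of_one_le₀ h.hlam.le)
      calc ENNReal.ofReal lam⁻¹ * edist (T x) (T y) ≤ 1 * edist (T x) (T y) := by gcongr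
        _ = _ := one_mul _
    calc edist (u x - f x) (u y - f y) ≤ edist (u x) (u y) + edist (f x) (f y) :=
          edist_sub_le_of_inv hinv _ _ _ _
      _ ≤ K i * edist x y + l i * edist x y :=
        add_le_add (hΩ i x hx y hy) (h.lip i x hxY (hΩa i hx) y hyY (hΩa i hy))
      _ = (K i + l i) * edist x y := by ring
      _ ≤ _ := by gcongr
  have hRt : ∀ i, K i + l i ≠ ⊤ := fun i => ENNReal.add_ne_top.2 ⟨hK i, hlt i⟩
  refine ⟨⟨∑ i ∈ F, (K i + l i), ?_, ?_⟩, ?_⟩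
  · exact ENNReal.sum_ne_top.2 fun i _ => hRt i
  · rintro A ⟨_, S, hA⟩
    by_cases hA0 : m A = 0
    · have h0 : essLip m u A ≤ 0 :=
        sInf_le ⟨∅, Set.empty_subset _, by simpa using hA0, by simp⟩
      exact h0.trans (by simp)
    · obtain ⟨j, hj⟩ : ∃ j, m (A ∩ α j) ≠ 0 := by
        by_contra! hh
        apply hA0
        refine measure_mono_null ?_ (measure_union_null (measure_iUnion_null hh) hGM.cover)
        intro x hx
        by_cases hx2 : x ∈ ⋃ i, α i
        · obtain ⟨i, hi⟩ := Set.mem_iUnion.1 hx2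
          exact Or.inl (Set.mem_iUnion.2 ⟨i, hx, hi⟩)
        · exact Or.inr hx2
      obtain ⟨i, hiF, hi⟩ := (hF j).1
      have hAi : A ⊆ T '' α i := by
        have hiS : i ∈ S := by
          by_contra hiS
          apply hj
          refine measure_mono_null ?_ hi
          rintro x ⟨hxA, hxj⟩
          refine ⟨hxj, ?_⟩
          rw [hA] at hxA
          exact Set.mem_iInter₂.1 hxA.2 i hiS
        intro x hx
        rw [hA] at hx
        exact Set.mem_iInter₂.1 hx.1 i hiS
      have h1 : essLip m u A ≤ K i + l i := by
        refine sInf_le ⟨A ∩ R i, Set.inter_subset_left, ?_, ?_⟩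
        · refine measure_mono_null ?_ (hRn i)
          rintro x ⟨hx1, hx2⟩
          exact ⟨hAi hx1, fun hh => hx2 ⟨hx1, hh⟩⟩
        · intro x hx y hy
          exact hRl i x hx.2 y hy.2
      exact h1.trans (Finset.single_le_sum (f := fun i => K i + l i)
        (fun _ _ => zero_le) hiF)
  · have hbd : Bornology.IsBounded (⋃ i ∈ F, u '' R i) := by
      rw [Bornology.isBounded_biUnion_finset]
      intro i _
      rw [Metric.isBounded_iff]
      refine ⟨((K i + l i) * ENNReal.ofReal D).toReal, ?_⟩
      rintro _ ⟨x, hx, rfl⟩ _ ⟨y, hy, rfl⟩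
      rw [dist_edist]
      refine ENNReal.toReal_mono (ENNReal.mul_ne_top (hRt i) ENNReal.ofReal_ne_top) ?_
      refine (hRl i x hx y hy).trans ?_
      gcongr
      rw [edist_dist]
      exact ENNReal.ofReal_le_ofReal (h.diam x y)
    obtain ⟨M, hM⟩ := hbd.subset_closedBall 0
    refine ⟨M, ?_⟩
    have h1 : ∀ᵐ x ∂m, ∀ i, x ∉ T '' α i \ R i :=
      ae_all_iff.2 fun i => measure_eq_zero_iff_ae_notMem.1 (hRn i)
    have h2 : ∀ᵐ x ∂m, ∀ j, x ∈ α j → ∃ i ∈ F, x ∈ T '' α i := by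
      rw [ae_all_iff]
      intro j
      obtain ⟨i, hiF, hi⟩ := (hF j).1
      filter_upwards [measure_eq_zero_iff_ae_notMem.1 hi] with x hx hxj
      refine ⟨i, hiF, ?_⟩
      by_contra hh
      exact hx ⟨hxj, hh⟩
    filter_upwards [h1, h2, measure_eq_zero_iff_ae_notMem.1 h.conull] with x hx1 hx2 hx3
    have hxY : x ∈ Y := by simpa using hx3
    obtain ⟨j, hj⟩ := h.cov x hxY
    obtain ⟨i, hiF, hi⟩ := hx2 j hj
    have hxR : x ∈ R i := by
      by_contra hh
      exact hx1 i ⟨hi, hh⟩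
    exact hM (Set.mem_biUnion hiF ⟨x, hxR, rfl⟩)
end

section
/- Under the hypotheses of the Livšic regularity theorem for probability preserving transitive Gibbs-Markov maps, there exists a constant C depending only on T such that sup_{a*∈α*} Du(a*) ≤ C·Σ_{a∈α} m(a)·Df(a). In particular, if f is constant on each element of α, then u is essentially constant on each element of α*. -/
open MeasureTheory Filter ENNReal

variable {X G ι : Type*}

namespace Livsic

section Aux
set_option linter.unusedSectionVars false
set_option linter.deprecated false
variable [MetricSpace X] [MeasurableSpace X]

/-- The infimum in the definition of the essential Lipschitz constant is attained. -/
lemma essLip_attained [PseudoEMetricSpace G] (m : Measure X) (f : X → G) (Z : Set X) :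
    ∃ Ω : Set X, Ω ⊆ Z ∧ m (Z \ Ω) = 0 ∧
      ∀ x ∈ Ω, ∀ y ∈ Ω, edist (f x) (f y) ≤ essLip m f Z * edist x y := by
  classical
  have hne : {C : ℝ≥0∞ | ∃ Ω : Set X, Ω ⊆ Z ∧ m (Z \ Ω) = 0 ∧
    ∀ x ∈ Ω, ∀ y ∈ Ω, edist (f x) (f y) ≤ C * edist x y}.Nonempty := by
    refine ⟨⊤, Z, subset_rfl, by simp, fun x _ y _ => ?_⟩
    by_cases h : x = y
    · subst h; simp
    · have : edist x y ≠ 0 := by simpa [edist_eq_zero] using h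
      rw [ENNReal.top_mul this]; exact le_top
  obtain ⟨c, -, hc, hcS⟩ := exists_seq_tendsto_sInf hne (OrderBot.bddBelow _)
  choose Ω hΩ hΩ0 hΩl using hcS
  refine ⟨⋂ n, Ω n, (Set.iInter_subset Ω 0).trans (hΩ 0), ?_, fun x hx y hy => ?_⟩
  · rw [Set.diff_iInter]
    exact measure_iUnion_null hΩ0
  · have h1 : Tendsto (fun n => c n * edist x y) atTop (nhds (essLip m f Z * edist x y)) :=
      ENNReal.Tendsto.mul_const hc (Or.inr (edist_ne_top x y))
    refine ge_of_tendsto' h1 fun n => ?_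
    exact hΩl n x (Set.mem_iInter.1 hx n) y (Set.mem_iInter.1 hy n)

lemma essLip_le [PseudoEMetricSpace G] {m : Measure X} {f : X → G} {Z : Set X} {C : ℝ≥0∞}
    (Ω : Set X) (h1 : Ω ⊆ Z) (h2 : m (Z \ Ω) = 0)
    (h3 : ∀ x ∈ Ω, ∀ y ∈ Ω, edist (f x) (f y) ≤ C * edist x y) : essLip m f Z ≤ C :=
  sInf_le ⟨Ω, h1, h2, h3⟩

lemma essLip_mono [PseudoEMetricSpace G] {m : Measure X} {f : X → G} {Z W : Set X}
    (h : m (Z \ W) = 0) : essLip m f Z ≤ essLip m f W := by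
  obtain ⟨Ω, h1, h2, h3⟩ := essLip_attained m f W
  refine essLip_le (Ω ∩ Z) Set.inter_subset_right ?_ fun x hx y hy => h3 x hx.1 y hy.1
  refine measure_mono_null ?_ (measure_union_null h h2)
  intro x hx
  by_cases hW : x ∈ W
  · exact Or.inr ⟨hW, fun hΩ => hx.2 ⟨hΩ, hx.1⟩⟩
  · exact Or.inl ⟨hx.1, hW⟩

lemma nullMeasurable_of_additive {m : Measure X} [IsFiniteMeasure m] {A B : Set X}
    (hU : NullMeasurableSet (A ∪ B) m) (hd : Disjoint A B)
    (hadd : m A + m B = m (A ∪ B)) : NullMeasurableSet A m := by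
  set A' := toMeasurable m A
  set B' := toMeasurable m B
  have hA : A ⊆ A' := subset_toMeasurable m A
  have hB : B ⊆ B' := subset_toMeasurable m B
  have h1 : m (A' ∪ B') + m (A' ∩ B') = m (A ∪ B) := by
    rw [measure_union_add_inter _ (measurableSet_toMeasurable m B), measure_toMeasurable,
      measure_toMeasurable, hadd]
  have h0 : m (A' ∩ B') = 0 := by
    have h2 : m (A ∪ B) ≤ m (A' ∪ B') := measure_mono (Set.union_subset_union hA hB)
    have h3 : m (A' ∪ B') + m (A' ∩ B') ≤ m (A' ∪ B') + 0 := by rw [h1, add_zero]; exact h2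
    exact le_antisymm ((ENNReal.add_le_add_iff_left (measure_ne_top m _)).1 h3) bot_le
  have h4 : A = (A' ∩ (A ∪ B)) \ (A' ∩ B) := by
    ext x
    have := hA (a := x)
    have h5 : x ∈ A → x ∉ B := fun h h' => Set.disjoint_left.1 hd h h'
    simp only [Set.mem_diff, Set.mem_inter_iff, Set.mem_union]
    tauto
  rw [h4]
  refine ((measurableSet_toMeasurable m A).nullMeasurableSet.inter hU).diff ?_
  exact NullMeasurableSet.of_null
    (measure_mono_null (Set.inter_subset_inter_right _ hB) h0)

/-- Cylinder sets. -/
def cyl (T : X → X) (α : ι → Set X) : List ι → Set X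
  | [] => Set.univ
  | i :: w => α i ∩ T ⁻¹' cyl T α w

/-- One-step Jacobian data. -/
structure Jac (m : Measure X) (T : X → X) (α : ι → Set X) (g : X → ℝ) : Prop where
  meas : ∀ i, MeasurableSet (α i)
  inj : ∀ i, Set.InjOn T (α i)
  gpos : ∀ x, 0 < g x
  jac : ∀ i, ∀ s : Set X, s ⊆ α i → MeasurableSet s →
        m (T '' s) = ∫⁻ x in s, ENNReal.ofReal (g x)⁻¹ ∂m
  nmeas : ∀ i, NullMeasurableSet (T '' α i) m

variable {m : Measure X} {T : X → X} {α : ι → Set X} {g : X → ℝ}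

lemma Jac.image_null (h : Jac m T α g) {i : ι} {s : Set X} (hs : s ⊆ α i) (h0 : m s = 0) :
    m (T '' s) = 0 := by
  refine measure_mono_null (Set.image_mono (t := toMeasurable m s ∩ α i)
    (Set.subset_inter (subset_toMeasurable m s) hs)) ?_
  rw [h.jac i _ Set.inter_subset_right ((measurableSet_toMeasurable m s).inter (h.meas i))]
  refine setLIntegral_measure_zero _ _ (measure_mono_null Set.inter_subset_left ?_)
  rw [measure_toMeasurable, h0]

lemma Jac.image_meas [IsFiniteMeasure m] (h : Jac m T α g) {i : ι} {s : Set X} (hs : s ⊆ α i)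
    (hm : MeasurableSet s) : NullMeasurableSet (T '' s) m := by
  have hU : T '' s ∪ T '' (α i \ s) = T '' α i := by
    rw [← Set.image_union, Set.union_diff_cancel hs]
  refine nullMeasurable_of_additive (B := T '' (α i \ s)) (by rw [hU]; exact h.nmeas i) ?_ ?_
  · exact Set.disjoint_image_image fun x hx y hy hxy => hy.2 (by
      rw [← h.inj i (hs hx) hy.1 hxy]; exact hx)
  · rw [hU, h.jac i s hs hm, h.jac i _ Set.diff_subset ((h.meas i).diff hm),
      h.jac i _ subset_rfl (h.meas i), ← lintegral_inter_add_sdiff _ (α i) hm,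
      Set.inter_eq_self_of_subset_right hs]

/-- Reduction of a null measurable set to a measurable one. -/
lemma Jac.image_nmeas [IsFiniteMeasure m] (h : Jac m T α g) {i : ι} {s : Set X} (hs : s ⊆ α i)
    (hm : NullMeasurableSet s m) : NullMeasurableSet (T '' s) m ∧
      ∃ t ⊆ s, MeasurableSet t ∧ m t = m s ∧ m (T '' t) = m (T '' s) := by
  obtain ⟨t, hts, htm, hte⟩ := hm.exists_measurable_subset_ae_eq
  have h0 : m (T '' (s \ t)) = 0 :=
    h.image_null (Set.diff_subset.trans hs) (ae_le_set.1 hte.symm.le)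
  have hU : T '' s = T '' t ∪ T '' (s \ t) := by
    rw [← Set.image_union, Set.union_diff_cancel hts]
  refine ⟨?_, t, hts, htm, measure_congr hte, ?_⟩
  · rw [hU]
    exact (h.image_meas (hts.trans hs) htm).union (NullMeasurableSet.of_null h0)
  · rw [hU]
    refine le_antisymm (measure_mono Set.subset_union_left) ?_
    exact (measure_union_le _ _).trans (by rw [h0, add_zero])

/-- A forward invariant set of full measure on which everything is controlled. -/
structure Good (m : Measure X) (T : X → X) (α : ι → Set X) (g : X → ℝ) (lam C Dm : ℝ)
    (X0 : Set X) : Prop where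
  conull : m X0ᶜ = 0
  fwd : ∀ x ∈ X0, T x ∈ X0
  cov : ∀ x ∈ X0, ∃ i, x ∈ α i
  one_lt : 1 < lam
  Cpos : 0 < C
  Dpos : 0 ≤ Dm
  diam : ∀ x y : X, dist x y ≤ Dm
  expand : ∀ i, ∀ x ∈ X0, ∀ y ∈ X0, x ∈ α i → y ∈ α i → lam * dist x y ≤ dist (T x) (T y)
  dist : ∀ i, ∀ x ∈ X0, ∀ y ∈ X0, x ∈ α i → y ∈ α i → |1 - g x / g y| ≤ C * dist (T x) (T y)

variable {lam C Dm : ℝ} {X0 : Set X}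

lemma Good.step [IsFiniteMeasure m] (hG : Good m T α g lam C Dm X0) (h : Jac m T α g) (i : ι)
    {r : ℝ} (hr : 0 ≤ r) {A : Set X} (hAi : A ⊆ α i)
    (hA : ∀ x ∈ A ∩ X0, ∀ y ∈ A ∩ X0, Dist.dist (T x) (T y) ≤ r) :
    ∃ κ : ℝ≥0∞, κ ≠ 0 ∧ κ ≠ ⊤ ∧ ∀ s ⊆ A, NullMeasurableSet s m →
      κ * m s ≤ m (T '' s) ∧ m (T '' s) ≤ κ * ENNReal.ofReal (Real.exp (2 * C * r)) * m s := by
  by_cases hne : (A ∩ X0).Nonempty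
  swap
  · have h0 : m A = 0 := measure_mono_null (fun x hx hx0 => hne ⟨x, hx, hx0⟩) hG.conull
    refine ⟨1, one_ne_zero, ENNReal.one_ne_top, fun s hs _ => ?_⟩
    have hs0 : m s = 0 := measure_mono_null hs h0
    rw [hs0, h.image_null (hs.trans hAi) hs0]; simp
  obtain ⟨x0, hx0⟩ := hne
  have hC := hG.Cpos
  have hb : 0 < 1 + C * r := by positivity
  have key : ∀ x ∈ A ∩ X0, ∀ y ∈ A ∩ X0, (g y)⁻¹ ≤ (1 + C * r) * (g x)⁻¹ := by
    intro x hx y hy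
    have h1 := hG.dist i x hx.2 y hy.2 (hAi hx.1) (hAi hy.1)
    have h2 : C * Dist.dist (T x) (T y) ≤ C * r := mul_le_mul_of_nonneg_left (hA x hx y hy) hC.le
    have h3 : g x / g y ≤ 1 + C * r := by
      have := (abs_le.1 h1).1; linarith
    have hx' := h.gpos x
    have hy' := h.gpos y
    rw [div_le_iff₀ hy'] at h3
    rw [← div_eq_mul_inv, inv_eq_one_div, div_le_div_iff₀ hy' hx']
    linarith
  have hgx := h.gpos x0
  refine ⟨ENNReal.ofReal ((g x0)⁻¹ / (1 + C * r)), ?_, ENNReal.ofReal_ne_top, fun s hs hm => ?_⟩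
  · rw [Ne, ENNReal.ofReal_eq_zero, not_le]; positivity
  obtain ⟨-, t, hts, htm, hte, htT⟩ := h.image_nmeas (hs.trans hAi) hm
  rw [← hte, ← htT, h.jac i t ((hts.trans hs).trans hAi) htm]
  have hae : ∀ᵐ x ∂m, x ∈ X0 := hG.conull
  constructor
  · rw [← setLIntegral_const]
    refine setLIntegral_mono_ae' htm ?_
    filter_upwards [hae] with x hx hxt
    apply ENNReal.ofReal_le_ofReal
    rw [div_le_iff₀ hb, mul_comm]
    exact key x ⟨hs (hts hxt), hx⟩ x0 hx0
  · rw [← setLIntegral_const]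
    refine setLIntegral_mono_ae' htm ?_
    filter_upwards [hae] with x hx hxt
    rw [← ENNReal.ofReal_mul (by positivity)]
    apply ENNReal.ofReal_le_ofReal
    refine (key x0 hx0 x ⟨hs (hts hxt), hx⟩).trans ?_
    have he : 1 + C * r ≤ Real.exp (C * r) := by
      have := Real.add_one_le_exp (C * r); linarith
    have he2 : Real.exp (2 * C * r) = Real.exp (C * r) * Real.exp (C * r) := by
      rw [← Real.exp_add]; ring_nf
    rw [he2, div_mul_eq_mul_div, le_div_iff₀ hb]
    have h5 : (1 + C * r) * (1 + C * r) ≤ Real.exp (C * r) * Real.exp (C * r) :=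
      mul_le_mul he he hb.le (Real.exp_pos _).le
    calc (1 + C * r) * (g x0)⁻¹ * (1 + C * r)
        = (g x0)⁻¹ * ((1 + C * r) * (1 + C * r)) := by ring
      _ ≤ _ := mul_le_mul_of_nonneg_left h5 (by positivity)

lemma Good.iter (hG : Good m T α g lam C Dm X0) {x : X} (hx : x ∈ X0) (n : ℕ) :
    T^[n] x ∈ X0 := by
  induction n generalizing x with
  | zero => exact hx
  | succ n ih => rw [Function.iterate_succ_apply]; exact ih (hG.fwd x hx)

/-- Two points with the same itinerary up to time `n`. -/
def Same (T : X → X) (α : ι → Set X) (n : ℕ) (x y : X) : Prop :=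
  ∀ k < n, ∀ i, T^[k] x ∈ α i → T^[k] y ∈ α i

lemma Good.same_expand (hG : Good m T α g lam C Dm X0) (n : ℕ) {x y : X} (hx : x ∈ X0)
    (hy : y ∈ X0) (h : Same T α n x y) :
    lam ^ n * Dist.dist x y ≤ Dist.dist (T^[n] x) (T^[n] y) := by
  induction n generalizing x y with
  | zero => simp
  | succ n ih =>
    obtain ⟨i, hi⟩ := hG.cov x hx
    have hyi : y ∈ α i := h 0 (Nat.succ_pos n) i hi
    have h1 := ih (hG.fwd x hx) (hG.fwd y hy) (fun k hk j hj => by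
      have := h (k + 1) (Nat.succ_lt_succ hk) j
      simp only [Function.iterate_succ_apply] at this
      exact this hj)
    rw [Function.iterate_succ_apply, Function.iterate_succ_apply]
    refine le_trans ?_ h1
    rw [pow_succ, mul_assoc]
    have := hG.one_lt
    exact mul_le_mul_of_nonneg_left (hG.expand i x hx y hy hi hyi) (by positivity)

lemma Good.same_dist (hG : Good m T α g lam C Dm X0) (n : ℕ) {x y : X} (hx : x ∈ X0)
    (hy : y ∈ X0) (h : Same T α n x y) : Dist.dist x y ≤ Dm * lam⁻¹ ^ n := by
  have h1 := (hG.same_expand n hx hy h).trans (hG.diam _ _)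
  have := hG.one_lt
  have hp : 0 < lam ^ n := by positivity
  rw [inv_pow, ← div_eq_mul_inv, le_div_iff₀ hp, mul_comm]
  exact h1

lemma mem_cyl_iff {w : List ι} {x : X} :
    x ∈ cyl T α w ↔ ∀ k (hk : k < w.length), T^[k] x ∈ α w[k] := by
  induction w generalizing x with
  | nil => simp [cyl]
  | cons i w ih =>
    simp only [cyl, Set.mem_inter_iff, Set.mem_preimage, ih, List.length_cons]
    constructor
    · rintro ⟨h0, h⟩ k hk
      cases k with
      | zero => simpa using h0
      | succ k => simpa [Function.iterate_succ_apply] using h k (by omega)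
    · intro h
      refine ⟨by simpa using h 0 (by omega), fun k hk => ?_⟩
      exact h (k + 1) (by omega)

lemma same_of_cyl (hd : Pairwise (Function.onFun Disjoint α)) {w : List ι} {x y : X}
    (hx : x ∈ cyl T α w) (hy : y ∈ cyl T α w) : Same T α w.length x y := by
  intro k hk i hi
  have h1 := mem_cyl_iff.1 hx k hk
  have h2 := mem_cyl_iff.1 hy k hk
  by_cases h : w[k] = i
  · rw [← h]; exact h2
  · exact absurd hi (Set.disjoint_left.1 (hd h) h1)

lemma cyl_meas (hT : Measurable T) (hα : ∀ i, MeasurableSet (α i)) (w : List ι) :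
    MeasurableSet (cyl T α w) := by
  induction w with
  | nil => exact MeasurableSet.univ
  | cons i w ih => exact (hα i).inter (hT ih)

lemma Good.exists_cyl (hG : Good m T α g lam C Dm X0) (n : ℕ) {x : X} (hx : x ∈ X0) :
    ∃ w : List ι, w.length = n ∧ x ∈ cyl T α w := by
  induction n generalizing x with
  | zero => exact ⟨[], rfl, trivial⟩
  | succ n ih =>
    obtain ⟨i, hi⟩ := hG.cov x hx
    obtain ⟨w, hw, hxw⟩ := ih (hG.fwd x hx)
    exact ⟨i :: w, by simp [hw], hi, hxw⟩

/-- Bounded distortion along cylinders. -/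
lemma Good.distort [IsFiniteMeasure m] (hG : Good m T α g lam C Dm X0) (h : Jac m T α g)
    (hd : Pairwise (Function.onFun Disjoint α)) (w : List ι) :
    ∃ κ : ℝ≥0∞, κ ≠ 0 ∧ κ ≠ ⊤ ∧ ∀ s ⊆ cyl T α w, NullMeasurableSet s m →
      κ * m s ≤ m (T^[w.length] '' s) ∧
      m (T^[w.length] '' s) ≤ κ * ENNReal.ofReal
        (Real.exp (2 * C * Dm * ∑ j ∈ Finset.range w.length, lam⁻¹ ^ j)) * m s := by
  induction w with
  | nil => exact ⟨1, one_ne_zero, ENNReal.one_ne_top, fun s _ _ => by simp⟩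
  | cons i w ih =>
    obtain ⟨κ, hκ0, hκt, hκ⟩ := ih
    have hl := hG.one_lt
    have hD := hG.Dpos
    obtain ⟨κ', hκ0', hκt', hκ'⟩ := hG.step h i (r := Dm * lam⁻¹ ^ w.length) (by positivity)
      (A := cyl T α (i :: w)) Set.inter_subset_left (fun x hx y hy =>
        hG.same_dist _ (hG.fwd x hx.2) (hG.fwd y hy.2) (same_of_cyl hd hx.1.2 hy.1.2))
    refine ⟨κ * κ', mul_ne_zero hκ0 hκ0', ENNReal.mul_ne_top hκt hκt', fun s hs hm => ?_⟩
    have h1 := hκ' s hs hm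
    have h2 := hκ (T '' s) (by rintro _ ⟨x, hx, rfl⟩; exact (hs hx).2)
      (h.image_nmeas (hs.trans Set.inter_subset_left) hm).1
    rw [List.length_cons, Function.iterate_succ, Set.image_comp]
    constructor
    · rw [mul_assoc]
      exact (mul_le_mul_right h1.1 κ).trans h2.1
    · refine h2.2.trans ((mul_le_mul_right h1.2 _).trans (le_of_eq ?_))
      rw [Finset.sum_range_succ, mul_add, Real.exp_add,
        ENNReal.ofReal_mul (Real.exp_pos _).le]
      have : 2 * C * Dm * lam⁻¹ ^ w.length = 2 * C * (Dm * lam⁻¹ ^ w.length) := by ring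
      rw [this]
      ring

end Aux

section Core
set_option linter.unusedSectionVars false
set_option linter.deprecated false
variable [MetricSpace X] [MeasurableSpace X]
variable {m : Measure X} {T : X → X} {α : ι → Set X} {g : X → ℝ}
variable {lam C Dm : ℝ} {X0 : Set X}

lemma exists_good [IsProbabilityMeasure m] (hpres : MeasurePreserving T m m)
    (hGM : GibbsMarkov m T α lam) :
    ∃ (g : X → ℝ) (C Dm : ℝ), Jac m T α g ∧ ∀ P : X → Prop, (∀ᵐ x ∂m, P x) →
      ∃ X0 : Set X, Good m T α g lam C Dm X0 ∧ ∀ x ∈ X0, P x := by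
  have hc := hGM.countable
  obtain ⟨g, hg0, hgj, C, hC, hgd⟩ := hGM.distortion
  obtain ⟨Dm, hDm⟩ := Metric.isBounded_iff.1 hGM.bounded
  have hDm' : ∀ x y : X, dist x y ≤ max Dm 0 := fun x y =>
    (hDm (Set.mem_univ x) (Set.mem_univ y)).trans (le_max_left _ _)
  refine ⟨g, C, max Dm 0, ⟨hGM.meas, hGM.inj, hg0, hgj, fun i => ?_⟩, fun P hP => ?_⟩
  · obtain ⟨s, hs⟩ := hGM.markov i
    have h1 : NullMeasurableSet (⋃ j ∈ s, α j) m :=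
      (MeasurableSet.biUnion s.to_countable fun j _ => hGM.meas j).nullMeasurableSet
    exact h1.congr (measure_symmDiff_eq_zero_iff.1 hs).symm
  choose Ω1 h1s h10 h1 using hGM.expand
  choose Ω2 h2s h20 h2 using hgd
  have hae : ∀ᵐ x ∂m, P x ∧ (∃ i, x ∈ α i) ∧ (∀ i, x ∈ α i → x ∈ Ω1 i) ∧
      (∀ i, x ∈ α i → x ∈ Ω2 i) := by
    have hcov : ∀ᵐ x ∂m, ∃ i, x ∈ α i := by
      refine measure_mono_null ?_ hGM.cover
      intro x hx; simpa using hx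
    have e1 : ∀ᵐ x ∂m, ∀ i, x ∈ α i → x ∈ Ω1 i := by
      rw [ae_all_iff]; intro i
      refine measure_mono_null ?_ (h10 i)
      intro x hx
      have hx' : ¬ (x ∈ α i → x ∈ Ω1 i) := hx
      push Not at hx'; exact hx'
    have e2 : ∀ᵐ x ∂m, ∀ i, x ∈ α i → x ∈ Ω2 i := by
      rw [ae_all_iff]; intro i
      refine measure_mono_null ?_ (h20 i)
      intro x hx
      have hx' : ¬ (x ∈ α i → x ∈ Ω2 i) := hx
      push Not at hx'; exact hx'
    filter_upwards [hP, hcov, e1, e2] with x a b c d using ⟨a, b, c, d⟩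
  have hall := ae_all_iff.2 fun k : ℕ => (hpres.iterate k).quasiMeasurePreserving.ae hae
  refine ⟨{x | ∀ k : ℕ, P (T^[k] x) ∧ (∃ i, T^[k] x ∈ α i) ∧ (∀ i, T^[k] x ∈ α i → T^[k] x ∈ Ω1 i) ∧
      (∀ i, T^[k] x ∈ α i → T^[k] x ∈ Ω2 i)}, ⟨hall, ?_, ?_, hGM.one_lt_lam, hC, le_max_right _ _,
      hDm', ?_, ?_⟩, fun x hx => (hx 0).1⟩
  · intro x hx k
    exact hx (k + 1)
  · intro x hx
    exact (hx 0).2.1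
  · intro i x hx y hy hxi hyi
    exact h1 i x ((hx 0).2.2.1 i hxi) y ((hy 0).2.2.1 i hyi)
  · intro i x hx y hy hxi hyi
    exact h2 i x ((hx 0).2.2.2 i hxi) y ((hy 0).2.2.2 i hyi)

lemma markov' (hGM : GibbsMarkov m T α lam) (j k : ι) (h : m (T '' α j ∩ α k) ≠ 0) :
    m (α k \ T '' α j) = 0 := by
  obtain ⟨s, hs⟩ := hGM.markov j
  by_cases hk : k ∈ s
  · refine measure_mono_null ?_ hs
    intro x hx
    exact Or.inr ⟨Set.mem_biUnion hk hx.1, hx.2⟩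
  · refine absurd (measure_mono_null ?_ hs) h
    intro x hx
    refine Or.inl ⟨hx.1, fun hx' => ?_⟩
    obtain ⟨l, hl, hxl⟩ := Set.mem_iUnion₂.1 hx'
    exact Set.disjoint_left.1 (hGM.disj (show l ≠ k from fun e => hk (e ▸ hl))) hxl hx.2

lemma Good.cyl_image [IsProbabilityMeasure m] (hG : Good m T α g lam C Dm X0) (h : Jac m T α g)
    (hGM : GibbsMarkov m T α lam) (w : List ι) (i : ι) (hw : m (cyl T α (w ++ [i])) ≠ 0) :
    m (T '' α i \ T^[w.length + 1] '' cyl T α (w ++ [i])) = 0 := by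
  induction w with
  | nil => simp [cyl]
  | cons j w ih =>
    set c' := cyl T α (w ++ [i]) with hc'
    have hc : cyl T α (j :: w ++ [i]) = α j ∩ T ⁻¹' c' := rfl
    rw [hc] at hw ⊢
    have hTc : T '' (α j ∩ T ⁻¹' c') = T '' α j ∩ c' := Set.image_inter_preimage _ _ _
    have hpos : m (T '' α j ∩ c') ≠ 0 := by
      rw [← hTc]
      intro h0
      obtain ⟨κ, hκ0, -, hκ⟩ := hG.distort h hGM.disj [j]
      have h1 := (hκ (α j ∩ T ⁻¹' c') (fun x hx => ⟨hx.1, trivial⟩)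
        (hc ▸ cyl_meas hGM.measT hGM.meas (j :: w ++ [i])).nullMeasurableSet).1
      simp only [List.length_singleton, Function.iterate_one, h0, nonpos_iff_eq_zero,
        mul_eq_zero] at h1
      exact h1.elim hκ0 hw
    obtain ⟨k, v, hkv⟩ : ∃ k v, w ++ [i] = k :: v := by
      cases w with
      | nil => exact ⟨i, [], rfl⟩
      | cons a b => exact ⟨a, b ++ [i], rfl⟩
    have hck : c' ⊆ α k := by rw [hc', hkv]; exact Set.inter_subset_left
    have hmk := markov' hGM j k (fun h0 => hpos (measure_mono_null
      (Set.inter_subset_inter_right _ hck) h0))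
    have hN : m (c' \ T '' α j) = 0 := measure_mono_null (Set.diff_subset_diff_left hck) hmk
    have hc'0 : m c' ≠ 0 := fun h0 => hpos (measure_mono_null Set.inter_subset_right h0)
    have hih := ih hc'0
    have hNT : m (T^[w.length + 1] '' (c' \ T '' α j)) = 0 := by
      obtain ⟨κ, -, -, hκ⟩ := hG.distort h hGM.disj (w ++ [i])
      have h1 := (hκ (c' \ T '' α j) Set.diff_subset (NullMeasurableSet.of_null hN)).2
      simp only [List.length_append, List.length_singleton, hN, mul_zero, nonpos_iff_eq_zero] at h1
      exact h1
    refine measure_mono_null ?_ (measure_union_null hih hNT)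
    rw [List.length_cons, Function.iterate_succ, Set.image_comp, hTc]
    intro x hx
    by_cases hxc : x ∈ T^[w.length + 1] '' c'
    · right
      obtain ⟨y, hy, rfl⟩ := hxc
      refine ⟨y, ⟨hy, fun hy' => hx.2 ⟨y, ⟨hy', hy⟩, rfl⟩⟩, rfl⟩
    · exact Or.inl ⟨hx.1, hxc⟩

lemma Good.lusin [IsProbabilityMeasure m] [BorelSpace X] [MetricSpace G] [MeasurableSpace G]
    [BorelSpace G] (hG : Good m T α g lam C Dm X0) {u : X → G} (hu : Measurable u)
    {S : Set G} (hS : TopologicalSpace.IsSeparable S) (huS : ∀ᵐ x ∂m, u x ∈ S)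
    {ε τ : ℝ≥0∞} (hε : ε ≠ 0) (hτ : τ ≠ 0) :
    ∃ N : Set X, MeasurableSet N ∧ m N ≤ τ ∧ ∀ x ∈ X0, x ∉ N → ∃ n : ℕ, ∃ p : G,
      ∀ y ∈ X0, y ∉ N → Same T α n x y → edist (u y) p < ε := by
  obtain ⟨Q, hQ, hSQ⟩ := hS
  have := hQ.to_subtype
  obtain ⟨t, ht0, ht⟩ := ENNReal.exists_pos_sum_of_countable' hτ Q
  let B : Q → Set X := fun q => u ⁻¹' (Metric.eball (q : G) ε)
  have hB : ∀ q, MeasurableSet (B q) := fun q => hu Metric.isOpen_eball.measurableSet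
  have hU : ∀ q, ∃ U ⊇ B q, IsOpen U ∧ m U < m (B q) + t q := fun q =>
    Set.exists_isOpen_lt_add (B q) (measure_ne_top m _) (ht0 q).ne'
  choose U hBU hUo hUm using hU
  have hdiff : ∀ q, m (U q \ B q) ≤ t q := fun q => by
    rw [measure_diff (hBU q) (hB q).nullMeasurableSet (measure_ne_top m _)]
    exact tsub_le_iff_left.2 (hUm q).le
  set N0 : Set X := (⋃ q, U q \ B q) ∪ {x | ¬ u x ∈ S} with hN0
  refine ⟨toMeasurable m N0, measurableSet_toMeasurable _ _, ?_, ?_⟩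
  · rw [measure_toMeasurable]
    refine (measure_union_le _ _).trans ?_
    rw [show m {x | ¬ u x ∈ S} = 0 from huS, add_zero]
    exact (measure_iUnion_le _).trans ((ENNReal.tsum_le_tsum hdiff).trans ht.le)
  · intro x hx hxN
    have hxN0 : x ∉ N0 := fun h => hxN (subset_toMeasurable m N0 h)
    have hxS : u x ∈ S := by
      by_contra h; exact hxN0 (Or.inr h)
    obtain ⟨q, hq, hqε⟩ := EMetric.mem_closure_iff.1 (hSQ hxS) ε hε.bot_lt
    have hxU : x ∈ U ⟨q, hq⟩ := hBU ⟨q, hq⟩ hqε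
    obtain ⟨δ, hδ, hball⟩ := Metric.isOpen_iff.1 (hUo ⟨q, hq⟩) x hxU
    have hl := hG.one_lt
    have hlim : Tendsto (fun n : ℕ => Dm * lam⁻¹ ^ n) atTop (nhds (Dm * 0)) :=
      (tendsto_pow_atTop_nhds_zero_of_lt_one (by positivity) (inv_lt_one_of_one_lt₀ hl)).const_mul _
    rw [mul_zero] at hlim
    obtain ⟨n, hn⟩ := (hlim.eventually (gt_mem_nhds hδ)).exists
    refine ⟨n, q, fun y hy hyN hxy => ?_⟩
    have hyU : y ∈ U ⟨q, hq⟩ := hball (by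
      rw [Metric.mem_ball, dist_comm]
      exact (hG.same_dist n hx hy hxy).trans_lt hn)
    by_contra hyB
    refine hyN (subset_toMeasurable m N0 (Or.inl (Set.mem_iUnion.2 ⟨⟨q, hq⟩, hyU, hyB⟩)))

lemma cyl_disj (hd : Pairwise (Function.onFun Disjoint α)) {w v : List ι}
    (hl : w.length = v.length) (hne : w ≠ v) : Disjoint (cyl T α w) (cyl T α v) := by
  rw [Set.disjoint_left]
  intro x hx hy
  apply hne
  refine List.ext_getElem hl fun k h1 h2 => ?_
  by_contra h
  exact Set.disjoint_left.1 (hd h) (mem_cyl_iff.1 hx k h1) (mem_cyl_iff.1 hy k h2)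

lemma Good.few_bad [IsProbabilityMeasure m] [BorelSpace X] [MetricSpace G] [MeasurableSpace G]
    [BorelSpace G] (hG : Good m T α g lam C Dm X0) (hGM : GibbsMarkov m T α lam)
    {u : X → G} (hu : Measurable u)
    {S : Set G} (hS : TopologicalSpace.IsSeparable S) (huS : ∀ᵐ x ∂m, u x ∈ S)
    {ε η τ : ℝ≥0∞} (hε : ε ≠ 0) (hη : η ≠ 0) (hη' : η ≠ ⊤) (hτ : τ ≠ 0) (hτ' : τ ≠ ⊤) :
    ∃ n0 : ℕ, ∀ n ≥ n0, m {x | ∃ w : List ι, w.length = n ∧ x ∈ cyl T α w ∧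
      ∀ p : G, ¬ (m (cyl T α w \ {y | edist (u y) p < ε}) ≤ η * m (cyl T α w))} ≤ τ := by
  have hcount := hGM.countable
  set t := τ / (2 + η⁻¹) with ht
  have ht0 : t ≠ 0 := by
    rw [ht, Ne, ENNReal.div_eq_zero_iff]
    push Not
    exact ⟨hτ, by simp [hη]⟩
  have htt : t ≠ ⊤ := ENNReal.div_ne_top hτ' (by simp)
  obtain ⟨N, hNm, hNt, hN⟩ := hG.lusin hu hS huS hε ht0
  let Fine : List ι → Prop := fun w => ∃ p : G, ∀ y ∈ X0, y ∉ N → y ∈ cyl T α w → edist (u y) p < ε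
  let E : ℕ → Set X := fun n => ⋃ w ∈ {w : List ι | n ≤ w.length ∧ ¬ Fine w}, cyl T α w
  have hEm : ∀ n, MeasurableSet (E n) := fun n =>
    MeasurableSet.biUnion (Set.to_countable _) fun w _ => cyl_meas hGM.measT hGM.meas w
  have hEa : Antitone E := fun a b hab => Set.biUnion_subset_biUnion_left
    fun w hw => ⟨hab.trans hw.1, hw.2⟩
  have hE0 : m (⋂ n, E n) ≤ t := by
    refine le_trans ?_ ((measure_union_le N X0ᶜ).trans (by rw [hG.conull, add_zero]; exact hNt))
    refine measure_mono fun x hx => ?_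
    by_contra hx'
    have hxN : x ∉ N := fun h => hx' (Or.inl h)
    have hx0 : x ∈ X0 := by by_contra h; exact hx' (Or.inr h)
    obtain ⟨n, p, hp⟩ := hN x hx0 hxN
    obtain ⟨w, hw, hxw⟩ := Set.mem_iUnion₂.1 (Set.mem_iInter.1 hx n)
    exact hw.2 ⟨p, fun y hy hyN hyw => hp y hy hyN fun k hk =>
      same_of_cyl hGM.disj hxw hyw k (hk.trans_le hw.1)⟩
  have hlim := tendsto_measure_iInter_atTop (μ := m) (fun n => (hEm n).nullMeasurableSet) hEa
    ⟨0, measure_ne_top m _⟩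
  have hlt : m (⋂ n, E n) < 2 * t := lt_of_le_of_lt hE0 (by
    rw [two_mul]; exact ENNReal.lt_add_right htt ht0)
  obtain ⟨n0, hn0⟩ := (hlim.eventually (gt_mem_nhds hlt)).exists
  refine ⟨n0, fun n hn => ?_⟩
  let J := {w : List ι // w.length = n ∧ η * m (cyl T α w) ≤ m (cyl T α w ∩ N)}
  have hJ : m (⋃ w : J, cyl T α w.1) ≤ η⁻¹ * t := by
    calc m (⋃ w : J, cyl T α w.1) ≤ ∑' w : J, m (cyl T α w.1) := measure_iUnion_le _
      _ ≤ ∑' w : J, η⁻¹ * m (cyl T α w.1 ∩ N) := by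
          refine ENNReal.tsum_le_tsum fun w => ?_
          have h1 := mul_le_mul_right w.2.2 η⁻¹
          rwa [← mul_assoc, ENNReal.inv_mul_cancel hη hη', one_mul] at h1
      _ = η⁻¹ * m (⋃ w : J, cyl T α w.1 ∩ N) := by
          rw [ENNReal.tsum_mul_left, measure_iUnion]
          · intro a b hab
            exact (cyl_disj hGM.disj (a.2.1.trans b.2.1.symm)
              (fun h => hab (Subtype.ext h))).mono Set.inter_subset_left Set.inter_subset_left
          · exact fun w => (cyl_meas hGM.measT hGM.meas w.1).inter hNm
      _ ≤ η⁻¹ * t := by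
          refine mul_le_mul_right ((measure_mono ?_).trans hNt) _
          exact Set.iUnion_subset fun w => Set.inter_subset_right
  calc _ ≤ m (E n0 ∪ ⋃ w : J, cyl T α w.1) := by
          refine measure_mono ?_
          rintro x ⟨w, hwn, hxw, hbad⟩
          by_cases hf : Fine w
          · right
            refine Set.mem_iUnion.2 ⟨⟨w, hwn, ?_⟩, hxw⟩
            obtain ⟨p, hp⟩ := hf
            refine (not_le.1 (hbad p)).le.trans ?_
            refine le_trans (measure_mono ?_) ((measure_union_le (cyl T α w ∩ N) X0ᶜ).trans
              (by rw [hG.conull, add_zero]))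
            intro y hy
            by_contra hy'
            have hyN : y ∉ N := fun h => hy' (Or.inl ⟨hy.1, h⟩)
            have hy0 : y ∈ X0 := by by_contra h; exact hy' (Or.inr h)
            exact hy.2 (hp y hy0 hyN hy.1)
          · left
            exact Set.mem_biUnion (show w ∈ {w : List ι | n0 ≤ w.length ∧ ¬ Fine w} from
              ⟨by rw [hwn]; exact hn, hf⟩) hxw
    _ ≤ 2 * t + η⁻¹ * t := (measure_union_le _ _).trans (add_le_add hn0.le hJ)
    _ = (2 + η⁻¹) * t := by ring
    _ ≤ τ := ENNReal.mul_div_le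

end Core

section Main
set_option linter.unusedSectionVars false
set_option linter.deprecated false
variable [MetricSpace X] [MeasurableSpace X]
variable {m : Measure X} {T : X → X} {α : ι → Set X} {g : X → ℝ}
variable {lam C Dm : ℝ} {X0 : Set X}

/-- The Lipschitz weights along an orbit. -/
noncomputable def phi (T : X → X) (r : ℝ≥0∞) (Lf : X → ℝ≥0∞) : ℕ → X → ℝ≥0∞
  | 0 => fun _ => 0
  | n + 1 => fun x => Lf x * r ^ (n + 1) + phi T r Lf n (T x)

lemma phi_meas {r : ℝ≥0∞} {Lf : X → ℝ≥0∞} (hT : Measurable T) (hL : Measurable Lf) (n : ℕ) :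
    Measurable (phi T r Lf n) := by
  induction n with
  | zero => exact measurable_const
  | succ n ih => exact (hL.mul_const _).add (ih.comp hT)

lemma phi_int {r : ℝ≥0∞} {Lf : X → ℝ≥0∞} (hpres : MeasurePreserving T m m)
    (hL : Measurable Lf) (n : ℕ) :
    ∫⁻ x, phi T r Lf n x ∂m = (∑ j ∈ Finset.range n, r ^ (j + 1)) * ∫⁻ x, Lf x ∂m := by
  induction n with
  | zero => simp [phi]
  | succ n ih =>
    simp only [phi]
    rw [lintegral_add_left (hL.mul_const _), lintegral_mul_const _ hL,
      hpres.lintegral_comp (phi_meas hpres.measurable hL n), ih, Finset.sum_range_succ]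
    ring

lemma edist_sub_sub_le [MetricSpace G] [AddCommGroup G]
    (hinv : ∀ g x y : G, dist (g + x) (g + y) = dist x y) (a b c d : G) :
    edist (a - b) (c - d) ≤ edist a c + edist b d := by
  have h1 : dist (a - b) (c - b) = dist a c := by
    have := hinv (-b) a c
    rwa [neg_add_eq_sub, neg_add_eq_sub] at this
  have h2 : dist (c - b) (c - d) = dist b d := by
    have := hinv (c - b - d) d b
    rw [show c - b - d + d = c - b by abel, show c - b - d + b = c - d by abel] at this
    rw [this, dist_comm]
  have h1' : edist (a - b) (c - b) = edist a c := by rw [edist_dist, edist_dist, h1]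
  have h2' : edist (c - b) (c - d) = edist b d := by rw [edist_dist, edist_dist, h2]
  rw [← h1', ← h2']
  exact edist_triangle _ _ _

lemma Good.phi_congr (hG : Good m T α g lam C Dm X0) {r : ℝ≥0∞} {Lf : X → ℝ≥0∞}
    (hLf : ∀ i x y, x ∈ α i → y ∈ α i → Lf x = Lf y)
    (n : ℕ) {x y : X} (hx : x ∈ X0) (hy : y ∈ X0) (h : Same T α n x y) :
    phi T r Lf n x = phi T r Lf n y := by
  induction n generalizing x y with
  | zero => rfl
  | succ n ih =>
    obtain ⟨i, hi⟩ := hG.cov x hx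
    have hyi : y ∈ α i := h 0 (Nat.succ_pos n) i hi
    have h1 := ih (hG.fwd x hx) (hG.fwd y hy) (fun k hk j hj => by
      have := h (k + 1) (Nat.succ_lt_succ hk) j
      simp only [Function.iterate_succ_apply] at this
      exact this hj)
    simp only [phi]
    rw [h1, hLf i x y hi hyi]

lemma Good.lip [MetricSpace G] [AddCommGroup G]
    (hinv : ∀ g x y : G, Dist.dist (g + x) (g + y) = Dist.dist x y)
    (hG : Good m T α g lam C Dm X0) {f u : X → G} {Lf : X → ℝ≥0∞}
    (hcoh : ∀ x ∈ X0, f x = u x - u (T x))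
    (hf : ∀ i, ∀ x ∈ X0, ∀ y ∈ X0, x ∈ α i → y ∈ α i → edist (f x) (f y) ≤ Lf x * edist x y)
    (n : ℕ) {x y : X} (hx : x ∈ X0) (hy : y ∈ X0) (h : Same T α n x y) :
    edist (u (T^[n] x)) (u (T^[n] y)) ≤ edist (u x) (u y) +
      phi T (ENNReal.ofReal lam⁻¹) Lf n x * edist (T^[n] x) (T^[n] y) := by
  induction n generalizing x y with
  | zero => simp [phi]
  | succ n ih =>
    obtain ⟨i, hi⟩ := hG.cov x hx
    have hyi : y ∈ α i := h 0 (Nat.succ_pos n) i hi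
    have h1 := ih (hG.fwd x hx) (hG.fwd y hy) (fun k hk j hj => by
      have := h (k + 1) (Nat.succ_lt_succ hk) j
      simp only [Function.iterate_succ_apply] at this
      exact this hj)
    have h2 : edist x y ≤ ENNReal.ofReal lam⁻¹ ^ (n + 1) * edist (T^[n + 1] x) (T^[n + 1] y) := by
      have h3 := hG.same_expand (n + 1) hx hy h
      have hl := hG.one_lt
      rw [edist_dist, edist_dist, ← ENNReal.ofReal_pow (by positivity),
        ← ENNReal.ofReal_mul (by positivity)]
      apply ENNReal.ofReal_le_ofReal
      rw [inv_pow, inv_mul_eq_div, le_div_iff₀ (by positivity), mul_comm]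
      exact h3
    have hux : u (T x) = u x - f x := by rw [hcoh x hx]; abel
    have huy : u (T y) = u y - f y := by rw [hcoh y hy]; abel
    rw [Function.iterate_succ_apply, Function.iterate_succ_apply] at h2 ⊢
    refine h1.trans ?_
    simp only [phi]
    rw [add_mul, ← add_assoc]
    refine add_le_add ?_ le_rfl
    rw [hux, huy]
    refine (edist_sub_sub_le hinv _ _ _ _).trans (add_le_add le_rfl ?_)
    refine (hf i x hx y hy hi hyi).trans ?_
    rw [mul_assoc]
    exact mul_le_mul_right h2 _

/-- The regularity theorem for essentially separably valued `u`. -/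
lemma core [BorelSpace X] [MetricSpace G] [AddCommGroup G] [MeasurableSpace G] [BorelSpace G]
    (hinv : ∀ g x y : G, dist (g + x) (g + y) = dist x y)
    [IsProbabilityMeasure m] (hpres : MeasurePreserving T m m) (hGM : GibbsMarkov m T α lam)
    (f u : X → G) (hu : Measurable u)
    {S : Set G} (hS : TopologicalSpace.IsSeparable S) (huS : ∀ᵐ x ∂m, u x ∈ S)
    (hfin : (∑' i, m (α i) * essLip m f (α i)) ≠ ⊤)
    (hcoh : ∀ᵐ x ∂m, f x = u x - u (T x)) (i : ι) :
    essLip m u (T '' α i) ≤ 2 * (1 - ENNReal.ofReal lam⁻¹)⁻¹ * (m (α i))⁻¹ *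
      ∑' i, m (α i) * essLip m f (α i) := by
  have hcount := hGM.countable
  have hl := hGM.one_lt_lam
  obtain ⟨g, C, Dm, hJ, hgood⟩ := exists_good hpres hGM
  choose Ω hΩs hΩ0 hΩ using fun i => essLip_attained m f (α i)
  have hae : ∀ᵐ x ∂m, f x = u x - u (T x) ∧ ∀ i, x ∈ α i → x ∈ Ω i := by
    refine hcoh.and (ae_all_iff.2 fun i => ?_)
    refine measure_mono_null ?_ (hΩ0 i)
    intro x hx
    have hx' : ¬ (x ∈ α i → x ∈ Ω i) := hx
    push Not at hx'; exact hx'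
  obtain ⟨X0, hG, hX0⟩ := hgood _ hae
  set Sg := ∑' i, m (α i) * essLip m f (α i) with hSg
  set r := ENNReal.ofReal lam⁻¹ with hr
  have hr1 : r < 1 := by
    rw [hr, ← ENNReal.ofReal_one]
    exact (ENNReal.ofReal_lt_ofReal_iff one_pos).2 (inv_lt_one_of_one_lt₀ hl)
  set q : ℝ≥0∞ := (1 - r)⁻¹ with hq
  have hqt : q ≠ ⊤ := by
    rw [hq, Ne, ENNReal.inv_eq_top]; exact (tsub_pos_of_lt hr1).ne'
  have hq0 : q ≠ 0 := by
    rw [hq, Ne, ENNReal.inv_eq_zero]; exact ENNReal.sub_ne_top ENNReal.one_ne_top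
  let Lf : X → ℝ≥0∞ := fun x => ∑' j, (α j).indicator (fun _ => essLip m f (α j)) x
  have hLfm : Measurable Lf :=
    Measurable.tsum fun j => measurable_const.indicator (hGM.meas j)
  have hLfi : ∫⁻ x, Lf x ∂m = Sg := by
    rw [lintegral_tsum fun j => (measurable_const.indicator (hGM.meas j)).aemeasurable]
    refine tsum_congr fun j => ?_
    rw [lintegral_indicator_const (hGM.meas j), mul_comm]
  have hLfx : ∀ j x, x ∈ α j → Lf x = essLip m f (α j) := by
    intro j x hx
    refine (tsum_eq_single j fun k hk => ?_).trans (Set.indicator_of_mem hx _)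
    exact Set.indicator_of_notMem (fun hxk => Set.disjoint_left.1 (hGM.disj hk) hxk hx) _
  have hflip : ∀ i, ∀ x ∈ X0, ∀ y ∈ X0, x ∈ α i → y ∈ α i →
      edist (f x) (f y) ≤ Lf x * edist x y := by
    intro j x hx y hy hxj hyj
    refine (hΩ j x ((hX0 x hx).2 j hxj) y ((hX0 y hy).2 j hyj)).trans ?_
    exact mul_le_mul_left (hLfx j x hxj).ge _
  have hphi : ∀ n, ∫⁻ x, phi T r Lf n x ∂m ≤ q * Sg := by
    intro n
    rw [phi_int hpres hLfm, hLfi]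
    refine mul_le_mul_left ?_ _
    rw [hq, ← ENNReal.tsum_geometric]
    refine le_trans (Finset.sum_le_sum fun j _ => ?_) (ENNReal.sum_le_tsum (Finset.range n))
    exact pow_le_pow_right_of_le_one' hr1.le (Nat.le_succ j)
  set μ := m (α i) with hμ
  have hμ0 : μ ≠ 0 := (hGM.pos i).ne'
  have hμt : μ ≠ ⊤ := measure_ne_top m _
  set K := 2 * q * μ⁻¹ * Sg with hK
  have hKt : K ≠ ⊤ := ENNReal.mul_ne_top (ENNReal.mul_ne_top (ENNReal.mul_ne_top
    ENNReal.ofNat_ne_top hqt) (ENNReal.inv_ne_top.2 hμ0)) hfin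
  have hlarge : ∀ n, m {x | K < phi T r Lf n x} ≤ μ / 2 := by
    intro n
    by_cases h0 : Sg = 0
    · have h1 : ∫⁻ x, phi T r Lf n x ∂m = 0 := by
        have := hphi n; rw [h0, mul_zero] at this; exact le_antisymm this bot_le
      rw [lintegral_eq_zero_iff (phi_meas hGM.measT hLfm n)] at h1
      have h2 : m {x | K < phi T r Lf n x} = 0 := by
        refine measure_mono_null ?_ h1
        intro x hx hx'
        have hx1 : K < phi T r Lf n x := hx
        have hx2 : phi T r Lf n x = 0 := hx'
        rw [hx2] at hx1
        exact not_lt_bot hx1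
      rw [h2]; exact bot_le
    · have hK0 : K ≠ 0 := mul_ne_zero (mul_ne_zero (mul_ne_zero two_ne_zero hq0)
        (ENNReal.inv_ne_zero.2 hμt)) h0
      have h1 : K * m {x | K < phi T r Lf n x} ≤ K * (μ / 2) := by
        calc K * m {x | K < phi T r Lf n x} ≤ K * m {x | K ≤ phi T r Lf n x} :=
              mul_le_mul_right (measure_mono fun x (hx : K < _) => hx.le) _
          _ ≤ q * Sg := (mul_meas_ge_le_lintegral (phi_meas hGM.measT hLfm n) K).trans (hphi n)
          _ = (2 * 2⁻¹) * (μ⁻¹ * μ) * (q * Sg) := by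
              rw [ENNReal.mul_inv_cancel two_ne_zero ENNReal.ofNat_ne_top,
                ENNReal.inv_mul_cancel hμ0 hμt, one_mul, one_mul]
          _ = K * (μ / 2) := by rw [hK, div_eq_mul_inv]; ring
      exact (ENNReal.mul_le_mul_iff_right hK0 hKt).1 h1
  -- uniform distortion bound
  set D : ℝ≥0∞ := ENNReal.ofReal (Real.exp (2 * C * Dm * (1 - lam⁻¹)⁻¹)) with hD
  have hDle : ∀ n : ℕ, ENNReal.ofReal
      (Real.exp (2 * C * Dm * ∑ j ∈ Finset.range n, lam⁻¹ ^ j)) ≤ D := by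
    intro n
    apply ENNReal.ofReal_le_ofReal
    apply Real.exp_le_exp.2
    have hC := hG.Cpos
    have hDm := hG.Dpos
    refine mul_le_mul_of_nonneg_left ?_ (by positivity)
    have h0 : (0 : ℝ) ≤ lam⁻¹ := by positivity
    rw [← tsum_geometric_of_lt_one h0 (inv_lt_one_of_one_lt₀ hl)]
    exact (summable_geometric_of_lt_one h0 (inv_lt_one_of_one_lt₀ hl)).sum_le_tsum _
      (fun j _ => by positivity)
  -- the key approximation
  have key : ∀ ε : ℝ≥0∞, ε ≠ 0 → ε ≠ ⊤ → ∃ Z : Set X, m (T '' α i \ Z) ≤ D * ε ∧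
      ∀ z ∈ Z, ∀ z' ∈ Z, edist (u z) (u z') ≤ 2 * ε + K * edist z z' := by
    intro ε hε hεt
    have hμ4 : μ / 4 ≠ 0 := (ENNReal.div_pos hμ0 ENNReal.ofNat_ne_top).ne'
    obtain ⟨n0, hn0⟩ := hG.few_bad hGM hu hS huS hε hε hεt hμ4
      (ENNReal.div_ne_top hμt (by norm_num))
    have hbad := hn0 (n0 + 1) (Nat.le_succ n0)
    set Bd : Set X := {x | ∃ w : List ι, w.length = n0 + 1 ∧ x ∈ cyl T α w ∧
      ∀ p : G, ¬ (m (cyl T α w \ {y | edist (u y) p < ε}) ≤ ε * m (cyl T α w))} with hBd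
    set Nc : Set X := ⋃ w ∈ {w : List ι | m (cyl T α w) = 0}, cyl T α w with hNc
    have hNc0 : m Nc = 0 := (measure_biUnion_null_iff (Set.to_countable _)).2 fun w hw => hw
    have hP : m (T^[n0] ⁻¹' α i) = μ :=
      (hpres.iterate n0).measure_preimage (hGM.meas i).nullMeasurableSet
    obtain ⟨x, hxP, hx⟩ : ∃ x ∈ T^[n0] ⁻¹' α i,
        x ∉ ({x | K < phi T r Lf (n0 + 1) x} ∪ Bd) ∪ (Nc ∪ X0ᶜ) := by
      by_contra hcon
      push Not at hcon
      have h1 : μ ≤ μ / 2 + μ / 4 := by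
        calc μ = m (T^[n0] ⁻¹' α i) := hP.symm
          _ ≤ m (({x | K < phi T r Lf (n0 + 1) x} ∪ Bd) ∪ (Nc ∪ X0ᶜ)) := measure_mono hcon
          _ ≤ m ({x | K < phi T r Lf (n0 + 1) x} ∪ Bd) + m (Nc ∪ X0ᶜ) := measure_union_le _ _
          _ = m ({x | K < phi T r Lf (n0 + 1) x} ∪ Bd) := by
              rw [measure_union_null hNc0 hG.conull, add_zero]
          _ ≤ _ := (measure_union_le _ _).trans (add_le_add (hlarge _) hbad)
      have h2 : μ / 2 + μ / 4 < μ / 2 + μ / 2 := by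
        refine ENNReal.add_lt_add_left (ENNReal.div_ne_top hμt two_ne_zero) ?_
        refine ENNReal.div_lt_div_left hμ0 hμt ?_
        norm_num
      rw [ENNReal.add_halves] at h2
      exact absurd h1 (not_le.2 h2)
    simp only [Set.mem_union, not_or] at hx
    obtain ⟨⟨hxK, hxB⟩, hxN, hx0⟩ := hx
    have hx0 : x ∈ X0 := by by_contra h; exact hx0 h
    obtain ⟨w, hwl, hxw⟩ := hG.exists_cyl (n0 + 1) hx0
    have hwm : m (cyl T α w) ≠ 0 := fun h0 => hxN (Set.mem_biUnion
      (show w ∈ {w : List ι | m (cyl T α w) = 0} from h0) hxw)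
    obtain ⟨p, hp⟩ : ∃ p : G, m (cyl T α w \ {y | edist (u y) p < ε}) ≤ ε * m (cyl T α w) := by
      by_contra hcon
      push Not at hcon
      exact hxB ⟨w, hwl, hxw, fun p => not_le.2 (hcon p)⟩
    have hxK : phi T r Lf (n0 + 1) x ≤ K := not_lt.1 hxK
    -- the last letter of `w` is `i`
    obtain ⟨v, j, hvj⟩ : ∃ v j, w = v ++ [j] := by
      rcases List.eq_nil_or_concat w with h | ⟨v, j, h⟩
      · rw [h] at hwl; simp at hwl
      · exact ⟨v, j, by simpa using h⟩
    have hvl : v.length = n0 := by rw [hvj] at hwl; simpa using hwl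
    have hji : j = i := by
      have h1 := mem_cyl_iff.1 hxw n0 (by omega)
      have h2 : w[n0]'(by omega) = j := by
        subst hvj; subst hvl; simp
      rw [h2] at h1
      by_contra hne
      exact Set.disjoint_left.1 (hGM.disj hne) h1 hxP
    subst hji
    have himg : m (T '' α j \ T^[w.length] '' cyl T α w) = 0 := by
      have := hG.cyl_image hJ hGM v j (hvj ▸ hwm)
      rw [hvj, List.length_append, List.length_singleton]
      exact this
    set b : Set X := cyl T α w ∩ {y | edist (u y) p < ε} ∩ X0 with hb
    have hX0m : NullMeasurableSet X0 m := (NullMeasurableSet.of_null hG.conull).of_compl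
    have hcm := cyl_meas hGM.measT hGM.meas w
    have hbm : NullMeasurableSet (cyl T α w \ b) m := by
      refine hcm.nullMeasurableSet.diff ?_
      refine (hcm.inter ?_).nullMeasurableSet.inter hX0m
      exact hu (Metric.isOpen_eball (x := p) (ε := ε)).measurableSet
    have hbsmall : m (cyl T α w \ b) ≤ ε * m (cyl T α w) := by
      refine le_trans ?_ hp
      refine (measure_mono (t := (cyl T α w \ {y | edist (u y) p < ε}) ∪ X0ᶜ) ?_).trans
        ((measure_union_le _ _).trans (by rw [hG.conull, add_zero]))
      intro y hy
      by_cases hy0 : y ∈ X0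
      · exact Or.inl ⟨hy.1, fun h => hy.2 ⟨⟨hy.1, h⟩, hy0⟩⟩
      · exact Or.inr hy0
    obtain ⟨κ, hκ0, hκt, hκ⟩ := hG.distort hJ hGM.disj w
    refine ⟨T^[w.length] '' b, ?_, ?_⟩
    · have h1 : T '' α j \ T^[w.length] '' b ⊆ (T '' α j \ T^[w.length] '' cyl T α w) ∪
          T^[w.length] '' (cyl T α w \ b) := by
        intro z hz
        by_cases hzc : z ∈ T^[w.length] '' cyl T α w
        · right
          obtain ⟨y, hy, rfl⟩ := hzc
          exact ⟨y, ⟨hy, fun hyb => hz.2 ⟨y, hyb, rfl⟩⟩, rfl⟩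
        · exact Or.inl ⟨hz.1, hzc⟩
      calc m (T '' α j \ T^[w.length] '' b)
          ≤ m (T '' α j \ T^[w.length] '' cyl T α w) + m (T^[w.length] '' (cyl T α w \ b)) :=
            (measure_mono h1).trans (measure_union_le _ _)
        _ = m (T^[w.length] '' (cyl T α w \ b)) := by rw [himg, zero_add]
        _ ≤ κ * D * m (cyl T α w \ b) := (hκ _ Set.diff_subset hbm).2.trans
            (mul_le_mul_left (mul_le_mul_right (hDle _) _) _)
        _ ≤ κ * D * (ε * m (cyl T α w)) := mul_le_mul_right hbsmall _
        _ = D * ε * (κ * m (cyl T α w)) := by ring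
        _ ≤ D * ε * 1 := mul_le_mul_right
            ((hκ _ subset_rfl hcm.nullMeasurableSet).1.trans prob_le_one) _
        _ = D * ε := mul_one _
    · rintro _ ⟨y, hy, rfl⟩ _ ⟨y', hy', rfl⟩
      have hS1 := same_of_cyl hGM.disj hy.1.1 hy'.1.1
      have h1 := hG.lip hinv (fun x hx => (hX0 x hx).1) hflip w.length hy.2 hy'.2 hS1
      refine h1.trans (add_le_add ?_ (mul_le_mul_left ?_ _))
      · refine (edist_triangle_right _ _ p).trans ?_
        rw [two_mul]
        exact add_le_add (le_of_lt hy.1.2) (le_of_lt hy'.1.2)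
      · rw [hG.phi_congr (fun k a c ha hc => (hLfx k a ha).trans (hLfx k c hc).symm) w.length
          hy.2 hx0 (same_of_cyl hGM.disj hy.1.1 hxw), hwl]
        exact hxK
  choose! Z hZm hZl using key
  let e : ℕ → ℝ≥0∞ := fun k => 2⁻¹ ^ k
  have he0 : ∀ k, e k ≠ 0 := fun k => pow_ne_zero _ (ENNReal.inv_ne_zero.2 ENNReal.ofNat_ne_top)
  have het : ∀ k, e k ≠ ⊤ := fun k => ENNReal.pow_ne_top (ENNReal.inv_ne_top.2 two_ne_zero)
  refine essLip_le {z | z ∈ T '' α i ∧ ∀ᶠ k in atTop, z ∈ Z (e k)} (fun z hz => hz.1) ?_ ?_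
  · have hsum : ∑' k, m {z | z ∈ T '' α i \ Z (e k)} ≠ ⊤ := by
      refine ne_top_of_le_ne_top ?_ (ENNReal.tsum_le_tsum fun k => hZm (e k) (he0 k) (het k))
      rw [ENNReal.tsum_mul_left, ENNReal.tsum_geometric, ENNReal.one_sub_inv_two, inv_inv]
      exact ENNReal.mul_ne_top ENNReal.ofReal_ne_top ENNReal.ofNat_ne_top
    refine measure_mono_null ?_ (measure_setOf_frequently_eq_zero hsum)
    intro z hz
    have h1 : ¬ ∀ᶠ k in atTop, z ∈ Z (e k) := fun h => hz.2 ⟨hz.1, h⟩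
    rw [not_eventually] at h1
    exact h1.mono fun k hk => ⟨hz.1, hk⟩
  · intro z hz z' hz'
    have hlim : Tendsto (fun k => 2 * e k + K * edist z z') atTop
        (nhds (2 * 0 + K * edist z z')) := by
      refine Tendsto.add (ENNReal.Tendsto.const_mul ?_ (Or.inr ENNReal.ofNat_ne_top))
        tendsto_const_nhds
      exact ENNReal.tendsto_pow_atTop_nhds_zero_of_lt_one (by
        rw [ENNReal.inv_lt_one]; norm_num)
    rw [mul_zero, zero_add] at hlim
    refine ge_of_tendsto hlim ?_
    filter_upwards [hz.2, hz'.2] with k h1 h2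
    exact hZl (e k) (he0 k) (het k) z h1 z' h2

end Main

section Sep
set_option linter.unusedSectionVars false
set_option linter.deprecated false
variable [MetricSpace X] [MeasurableSpace X]
variable {m : Measure X} {T : X → X} {α : ι → Set X} {g : X → ℝ}
variable {lam C Dm : ℝ} {X0 : Set X}

lemma topGroup [MetricSpace G] [AddCommGroup G]
    (hinv : ∀ g x y : G, dist (g + x) (g + y) = dist x y) : IsTopologicalAddGroup G := by
  have hneg : Continuous fun x : G => -x := by
    refine (LipschitzWith.of_edist_le fun x y => ?_ : LipschitzWith 1 fun x : G => -x).continuous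
    have := edist_sub_sub_le hinv 0 x 0 y
    simpa using this
  have hsub : Continuous fun p : G × G => p.1 - p.2 := by
    refine (show LipschitzWith 2 fun p : G × G => p.1 - p.2 from fun p q => ?_).continuous
    refine (edist_sub_sub_le hinv p.1 p.2 q.1 q.2).trans ?_
    rw [ENNReal.coe_ofNat, two_mul]
    exact add_le_add (le_max_left _ _) (le_max_right _ _)
  have hadd : Continuous fun p : G × G => p.1 + p.2 := by
    have := hsub.comp (continuous_fst.prodMk (hneg.comp continuous_snd))
    simpa [Function.comp_def] using this
  exact { continuous_add := hadd, continuous_neg := hneg }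

lemma zero_one [BorelSpace X] [IsProbabilityMeasure m] (hpres : MeasurePreserving T m m)
    (hGM : GibbsMarkov m T α lam) {B : Set X} (hB : MeasurableSet B)
    (hinvB : ∀ᵐ x ∂m, (x ∈ B ↔ T x ∈ B)) (j : ι) : m (α j ∩ B) = 0 ∨ m (α j \ B) = 0 := by
  classical
  obtain ⟨F, hF⟩ := hGM.bip
  obtain ⟨i, -, hi⟩ := (hF j).1
  have hf0 : ∀ k, essLip m (fun _ : X => (0 : ℝ)) (α k) = 0 := fun k =>
    le_antisymm (essLip_le (α k) subset_rfl (by simp) (by simp)) bot_le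
  have hcoh : ∀ᵐ x ∂m, (fun _ : X => (0 : ℝ)) x =
      B.indicator (fun _ => (1 : ℝ)) x - B.indicator (fun _ => (1 : ℝ)) (T x) := by
    filter_upwards [hinvB] with x hx
    by_cases h : x ∈ B
    · simp [h, hx.1 h]
    · have h' : T x ∉ B := fun h' => h (hx.2 h')
      simp [h, h']
  have h1 := core (G := ℝ) (fun g x y => dist_add_left g x y) hpres hGM (fun _ => 0)
    (B.indicator fun _ => (1 : ℝ)) (measurable_const.indicator hB)
    (TopologicalSpace.IsSeparable.of_separableSpace (Set.univ : Set ℝ))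
    (Eventually.of_forall fun _ => trivial) (by simp [hf0]) hcoh i
  simp only [hf0, mul_zero, tsum_zero] at h1
  have h2 := (essLip_mono (f := B.indicator fun _ => (1 : ℝ)) hi).trans h1
  obtain ⟨Ω, hΩ, hΩ0, hΩl⟩ := essLip_attained m (B.indicator fun _ => (1 : ℝ)) (α j)
  have hconst : ∀ x ∈ Ω, ∀ y ∈ Ω, B.indicator (fun _ => (1 : ℝ)) x =
      B.indicator (fun _ => (1 : ℝ)) y := by
    intro x hx y hy
    have := hΩl x hx y hy
    rw [le_antisymm h2 bot_le, zero_mul] at this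
    exact edist_eq_zero.1 (le_antisymm this bot_le)
  by_cases hne : (Ω ∩ B).Nonempty
  · right
    obtain ⟨x, hx, hxB⟩ := hne
    refine measure_mono_null ?_ hΩ0
    intro y hy
    refine ⟨hy.1, fun hyΩ => ?_⟩
    have := hconst x hx y hyΩ
    simp [hxB, hy.2] at this
  · left
    refine measure_mono_null ?_ hΩ0
    intro y hy
    exact ⟨hy.1, fun hyΩ => hne ⟨y, hyΩ, hy.2⟩⟩

lemma Good.sep (hG : Good m T α g lam C Dm X0) (hGM : GibbsMarkov m T α lam) :
    TopologicalSpace.IsSeparable X0 := by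
  classical
  have := hGM.countable
  obtain ⟨t, -, ht, hst⟩ := EMetric.subset_countable_closure_of_almost_dense_set X0 (by
    intro ε hε
    have hl := hG.one_lt
    have hlim : Tendsto (fun n : ℕ => ENNReal.ofReal (Dm * lam⁻¹ ^ n)) atTop
        (nhds (ENNReal.ofReal (Dm * 0))) :=
      ENNReal.tendsto_ofReal ((tendsto_pow_atTop_nhds_zero_of_lt_one (by positivity)
        (inv_lt_one_of_one_lt₀ hl)).const_mul _)
    rw [mul_zero, ENNReal.ofReal_zero] at hlim
    obtain ⟨n, hn⟩ := (hlim.eventually (gt_mem_nhds hε)).exists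
    let I := {w : List ι // w.length = n ∧ (cyl T α w ∩ X0).Nonempty}
    let c : I → X := fun w => w.2.2.some
    refine ⟨Set.range c, Set.countable_range c, fun x hx => ?_⟩
    obtain ⟨w, hw, hxw⟩ := hG.exists_cyl n hx
    let w' : I := ⟨w, hw, x, hxw, hx⟩
    have hc : c w' ∈ cyl T α w ∩ X0 := w'.2.2.some_mem
    refine Set.mem_biUnion (Set.mem_range_self w') ?_
    rw [Metric.mem_closedEBall, edist_dist]
    refine le_trans (ENNReal.ofReal_le_ofReal ?_) hn.le
    refine hG.same_dist n hx hc.2 ?_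
    rw [← hw]
    exact same_of_cyl hGM.disj hxw hc.1)
  exact ⟨t, ht, hst⟩

lemma ess_separable [BorelSpace X] [MetricSpace G] [AddCommGroup G] [MeasurableSpace G]
    [BorelSpace G] [LocallyCompactSpace G]
    (hinv : ∀ g x y : G, dist (g + x) (g + y) = dist x y)
    [IsProbabilityMeasure m] (hpres : MeasurePreserving T m m) (hGM : GibbsMarkov m T α lam)
    (f u : X → G) (hu : Measurable u)
    (hfin : (∑' i, m (α i) * essLip m f (α i)) ≠ ⊤)
    (hcoh : ∀ᵐ x ∂m, f x = u x - u (T x)) :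
    ∃ S : Set G, TopologicalSpace.IsSeparable S ∧ ∀ᵐ x ∂m, u x ∈ S := by
  classical
  have hcount := hGM.countable
  have htg := topGroup hinv
  obtain ⟨g, C, Dm, hJ, hgood⟩ := exists_good hpres hGM
  choose Ω hΩs hΩ0 hΩ using fun i => essLip_attained m f (α i)
  have hae : ∀ᵐ x ∂m, f x = u x - u (T x) ∧ ∀ i, x ∈ α i → x ∈ Ω i := by
    refine hcoh.and (ae_all_iff.2 fun i => ?_)
    refine measure_mono_null ?_ (hΩ0 i)
    intro x hx
    have hx' : ¬ (x ∈ α i → x ∈ Ω i) := hx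
    push Not at hx'; exact hx'
  obtain ⟨X0, hG, hX0⟩ := hgood _ hae
  have hXsep := hG.sep hGM
  have hLt : ∀ i, essLip m f (α i) ≠ ⊤ := by
    intro i h
    have h1 : m (α i) * essLip m f (α i) ≠ ⊤ := ENNReal.ne_top_of_tsum_ne_top hfin i
    rw [h, ENNReal.mul_top (hGM.pos i).ne'] at h1
    exact h1 rfl
  have hRi : ∀ i, TopologicalSpace.IsSeparable (f '' (X0 ∩ α i)) := by
    intro i
    refine ContinuousOn.isSeparable_image ?_ (hXsep.mono Set.inter_subset_left)
    refine LipschitzOnWith.continuousOn (K := (essLip m f (α i)).toNNReal) ?_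
    intro x hx y hy
    rw [ENNReal.coe_toNNReal (hLt i)]
    exact hΩ i x ((hX0 x hx.1).2 i hx.2) y ((hX0 y hy.1).2 i hy.2)
  obtain ⟨Kc, hKc, hK0⟩ := exists_compact_mem_nhds (0 : G)
  have hRsep : TopologicalSpace.IsSeparable ((⋃ i, f '' (X0 ∩ α i)) ∪ Kc) :=
    (TopologicalSpace.IsSeparable.iUnion hRi).union hKc.isSeparable
  set R := (⋃ i, f '' (X0 ∩ α i)) ∪ Kc with hR
  set M := Submodule.span ℤ R with hM
  have hMsep : TopologicalSpace.IsSeparable (M : Set G) := hRsep.span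
  have hRM : R ⊆ M := Submodule.subset_span
  set H : AddSubgroup G := M.toAddSubgroup with hH
  have hHo : IsOpen (H : Set G) := AddSubgroup.isOpen_of_mem_nhds H (g := 0)
    (mem_of_superset hK0 (Set.subset_union_right.trans hRM))
  let w : X → G ⧸ H := fun x => QuotientAddGroup.mk (u x)
  have hwm : ∀ A : Set (G ⧸ H), MeasurableSet (w ⁻¹' A) := by
    intro A
    have hdisc : DiscreteTopology (G ⧸ H) := QuotientAddGroup.discreteTopology hHo
    have : IsOpen ((QuotientAddGroup.mk : G → G ⧸ H) ⁻¹' A) :=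
      (isOpen_discrete A).preimage continuous_quot_mk
    exact hu this.measurableSet
  have hwT : ∀ x ∈ X0, w x = w (T x) := by
    intro x hx
    refine (QuotientAddGroup.eq.2 ?_).symm
    obtain ⟨i, hi⟩ := hG.cov x hx
    have h1 : f x ∈ M := hRM (Or.inl (Set.mem_iUnion.2 ⟨i, x, ⟨hx, hi⟩, rfl⟩))
    rw [(hX0 x hx).1] at h1
    rw [neg_add_eq_sub]
    exact h1
  have hX0ae : ∀ᵐ x ∂m, x ∈ X0 := hG.conull
  have h01 : ∀ (A : Set (G ⧸ H)) (j : ι), m (α j ∩ w ⁻¹' A) = 0 ∨ m (α j \ w ⁻¹' A) = 0 := by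
    intro A j
    refine zero_one hpres hGM (hwm A) ?_ j
    filter_upwards [hX0ae] with x hx
    rw [Set.mem_preimage, Set.mem_preimage, hwT x hx]
  -- `w` is essentially constant on each `α j`
  have hne : Nonempty X := by
    by_contra h
    rw [not_nonempty_iff] at h
    have := measure_univ (μ := m)
    rw [Set.univ_eq_empty_iff.2 h, measure_empty] at this
    exact zero_ne_one this
  have hconst : ∀ j, ∃ e : G ⧸ H, ∀ᵐ x ∂m, x ∈ α j → w x = e := by
    intro j
    let σ : G ⧸ H → X := fun e => if h : ∃ x ∈ X0, w x = e then h.choose else hne.some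
    have hσ : ∀ x ∈ X0, σ (w x) ∈ X0 ∧ w (σ (w x)) = w x := by
      intro x hx
      have h : ∃ y ∈ X0, w y = w x := ⟨x, hx, rfl⟩
      have : σ (w x) = h.choose := dif_pos h
      rw [this]
      exact h.choose_spec
    obtain ⟨Q, hQ, hXQ⟩ := hXsep
    have hQ' := hQ.to_subtype
    have hstep : ∀ n : ℕ, ∃ q : X, ∀ᵐ x ∂m, x ∈ α j → dist (σ (w x)) q < 1 / ((n : ℝ) + 1) := by
      intro n
      by_contra hcon
      have hcon2 : ∀ q : X, ¬ ∀ᵐ x ∂m, x ∈ α j → dist (σ (w x)) q < 1 / ((n : ℝ) + 1) :=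
        fun q h => hcon ⟨q, h⟩
      have hz : ∀ q : Q, m (α j ∩ w ⁻¹' {e | dist (σ e) q < 1 / ((n : ℝ) + 1)}) = 0 := by
        intro q
        refine (h01 _ j).resolve_right fun h0 => ?_
        refine hcon2 q ?_
        refine measure_mono_null ?_ h0
        intro x hx
        have hx' : ¬ (x ∈ α j → dist (σ (w x)) q < 1 / ((n : ℝ) + 1)) := hx
        push Not at hx'
        exact ⟨hx'.1, fun h => absurd h (not_lt.2 hx'.2)⟩
      have hall := measure_union_null (measure_iUnion_null hz) hG.conull
      refine (hGM.pos j).ne' (measure_mono_null ?_ hall)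
      intro x hx
      by_cases hx0 : x ∈ X0
      · left
        obtain ⟨q, hq, hqd⟩ := Metric.mem_closure_iff.1 (hXQ (hσ x hx0).1) (1 / ((n : ℝ) + 1))
          (by positivity)
        exact Set.mem_iUnion.2 ⟨⟨q, hq⟩, hx, hqd⟩
      · exact Or.inr hx0
    choose q hq using hstep
    have hqall := ae_all_iff.2 hq
    by_cases hex : ∃ x0 ∈ X0, x0 ∈ α j ∧ ∀ n : ℕ, dist (σ (w x0)) (q n) < 1 / ((n : ℝ) + 1)
    · obtain ⟨x0, hx0, hxj, hx0q⟩ := hex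
      refine ⟨w x0, ?_⟩
      filter_upwards [hqall, hX0ae] with x hx hxX hxα
      have heq : σ (w x) = σ (w x0) := by
        refine eq_of_dist_eq_zero (le_antisymm ?_ dist_nonneg)
        have hlim : Tendsto (fun n : ℕ => 1 / ((n : ℝ) + 1) + 1 / ((n : ℝ) + 1)) atTop
            (nhds (0 + 0)) :=
          tendsto_one_div_add_atTop_nhds_zero_nat.add tendsto_one_div_add_atTop_nhds_zero_nat
        rw [add_zero] at hlim
        refine ge_of_tendsto' hlim fun n => ?_
        exact (dist_triangle_right _ _ (q n)).trans (add_le_add (hx n hxα).le (hx0q n).le)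
      rw [← (hσ x hxX).2, heq, (hσ x0 hx0).2]
    · refine ⟨0, ?_⟩
      filter_upwards [hqall, hX0ae] with x hx hxX hxα
      exact absurd ⟨x, hxX, hxα, fun n => hx n hxα⟩ hex
  choose e he using hconst
  refine ⟨⋃ j, (fun h => (e j).out + h) '' (M : Set G),
    TopologicalSpace.IsSeparable.iUnion fun j => hMsep.image (continuous_const.add continuous_id),
    ?_⟩
  filter_upwards [ae_all_iff.2 he, hX0ae] with x hx hx0
  obtain ⟨j, hj⟩ := hG.cov x hx0
  have h1 : (QuotientAddGroup.mk (e j).out : G ⧸ H) = QuotientAddGroup.mk (u x) := by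
    rw [QuotientAddGroup.out_eq']; exact (hx j hj).symm
  have h2 : -(e j).out + u x ∈ H := QuotientAddGroup.eq.1 h1
  exact Set.mem_iUnion.2 ⟨j, -(e j).out + u x, h2, by simp⟩

end Sep

end Livsic

/-- There is a constant `C` depending only on `T` such that
`sup_{a* ∈ α*} Du(a*) ≤ C ∑_{a ∈ α} m(a) Df(a)`. In particular, if `f` is constant
on each element of `α`, then `u` is essentially constant on each element of `α*`. -/
theorem livsic_regularity_constant
    [MetricSpace X] [MeasurableSpace X] [BorelSpace X]
    [MetricSpace G] [AddCommGroup G] [MeasurableSpace G] [BorelSpace G]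
    [LocallyCompactSpace G]
    (hinv : ∀ g x y : G, dist (g + x) (g + y) = dist x y)
    (m : Measure X) [IsProbabilityMeasure m]
    (T : X → X) (hpres : MeasurePreserving T m m)
    (α : ι → Set X) (lam : ℝ) (hGM : GibbsMarkov m T α lam)
    (htrans : ∀ i j, ∃ n : ℕ, m (α j \ T^[n] '' α i) = 0) :
    ∃ C : ℝ≥0∞, C ≠ ⊤ ∧ ∀ f u : X → G, Measurable u →
      (∑' i, m (α i) * essLip m f (α i)) ≠ ⊤ →
      (∀ᵐ x ∂m, f x = u x - u (T x)) →
      (∀ A : Set X, isImageAtom T α A →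
        essLip m u A ≤ C * ∑' i, m (α i) * essLip m f (α i)) ∧
      ((∀ i, ∃ c : G, ∀ x ∈ α i, f x = c) →
        ∀ A : Set X, isImageAtom T α A →
          ∃ c : G, ∀ᵐ x ∂(m.restrict A), u x = c) := by
  classical
  obtain ⟨F, hF⟩ := hGM.bip
  set q : ℝ≥0∞ := 2 * (1 - ENNReal.ofReal lam⁻¹)⁻¹ with hq
  have hl := hGM.one_lt_lam
  have hr1 : ENNReal.ofReal lam⁻¹ < 1 := by
    rw [← ENNReal.ofReal_one]
    exact (ENNReal.ofReal_lt_ofReal_iff one_pos).2 (inv_lt_one_of_one_lt₀ hl)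
  have hqt : q ≠ ⊤ := by
    refine ENNReal.mul_ne_top ENNReal.ofNat_ne_top ?_
    rw [Ne, ENNReal.inv_eq_top]; exact (tsub_pos_of_lt hr1).ne'
  have hcount := hGM.countable
  refine ⟨q * ∑ i ∈ F, (m (α i))⁻¹, ENNReal.mul_ne_top hqt
    (ENNReal.sum_ne_top.2 fun i _ => ENNReal.inv_ne_top.2 (hGM.pos i).ne'), ?_⟩
  intro f u hu hfin hcoh
  obtain ⟨S, hS, huS⟩ := Livsic.ess_separable hinv hpres hGM f u hu hfin hcoh
  have main : ∀ A : Set X, isImageAtom T α A →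
      essLip m u A ≤ (q * ∑ i ∈ F, (m (α i))⁻¹) * ∑' i, m (α i) * essLip m f (α i) := by
    rintro A ⟨-, S', rfl⟩
    by_cases hex : ∃ i ∈ F, i ∈ S'
    · obtain ⟨i, hiF, hiS⟩ := hex
      have hsub : (⋂ i ∈ S', T '' α i) ∩ (⋂ i ∈ S'ᶜ, (T '' α i)ᶜ) ⊆ T '' α i :=
        fun x hx => Set.mem_iInter₂.1 hx.1 i hiS
      refine (Livsic.essLip_mono (W := T '' α i) (by
        rw [Set.sdiff_eq_empty.2 hsub, measure_empty])).trans ?_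
      refine (Livsic.core hinv hpres hGM f u hu hS huS hfin hcoh i).trans ?_
      refine mul_le_mul_left (mul_le_mul_right ?_ _) _
      exact Finset.single_le_sum (f := fun i => (m (α i))⁻¹) (fun _ _ => bot_le) hiF
    · push Not at hex
      have h0 : m ((⋂ i ∈ S', T '' α i) ∩ (⋂ i ∈ S'ᶜ, (T '' α i)ᶜ)) = 0 := by
        choose i' hi' hi0 using fun j => (hF j).1
        refine measure_mono_null ?_ (measure_union_null (measure_iUnion_null hi0) hGM.cover)
        intro x hx
        by_cases hxc : x ∈ ⋃ i, α i
        · left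
          obtain ⟨j, hj⟩ := Set.mem_iUnion.1 hxc
          exact Set.mem_iUnion.2 ⟨j, hj, Set.mem_iInter₂.1 hx.2 (i' j) (hex _ (hi' j))⟩
        · exact Or.inr hxc
      refine (Livsic.essLip_le (C := 0) ∅ (Set.empty_subset _) (by
        rw [Set.sdiff_empty]; exact h0) (by simp)).trans bot_le
  refine ⟨main, fun hc A hA => ?_⟩
  have hf0 : ∀ i, essLip m f (α i) = 0 := fun i => by
    obtain ⟨c, hc⟩ := hc i
    refine le_antisymm (Livsic.essLip_le (α i) subset_rfl (by simp) fun x hx y hy => ?_) bot_le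
    rw [hc x hx, hc y hy]; simp
  have h1 := main A hA
  simp only [hf0, mul_zero, tsum_zero] at h1
  obtain ⟨Ω, hΩs, hΩ0, hΩ⟩ := Livsic.essLip_attained m u A
  have hconst : ∀ x ∈ Ω, ∀ y ∈ Ω, u x = u y := by
    intro x hx y hy
    have := hΩ x hx y hy
    rw [le_antisymm h1 bot_le, zero_mul] at this
    exact edist_eq_zero.1 (le_antisymm this bot_le)
  by_cases hne : Ω.Nonempty
  · obtain ⟨x0, hx0⟩ := hne
    refine ⟨u x0, ?_⟩
    refine (ae_restrict_iff (p := fun x => u x = u x0)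
      (hu (measurableSet_singleton (u x0)))).2 ?_
    refine measure_mono_null ?_ hΩ0
    intro x hx
    have hx' : ¬ (x ∈ A → u x = u x0) := hx
    push Not at hx'
    exact ⟨hx'.1, fun h => hx'.2 (hconst x h x0 hx0)⟩
  · refine ⟨0, ?_⟩
    refine (ae_restrict_iff (p := fun x => u x = 0)
      (hu (measurableSet_singleton (0 : G)))).2 ?_
    refine measure_mono_null ?_ hΩ0
    intro x hx
    have hx' : ¬ (x ∈ A → u x = 0) := hx
    push Not at hx'
    exact ⟨hx'.1, fun h => hne ⟨x, h⟩⟩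
end
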